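/- arXiv:1604.00338 — 3 statements merged into one kernel-verified Lean document; each statement's English description precedes it below -/
import Mathlib

section
/- Let K be a field, q a nonzero element of K, and x an m×n q-matrix with entries in an associative unital K-algebra A. Let 1 ≤ i < j < k ≤ n, let X ⊆ {1,…,n} − {i,j,k}, and suppose m ≥ |X| + 2. Then the flag quantum minors satisfy the commutation relation [Xik]·[Xj] = q [Xj]·[Xik] − (q − q⁻¹) [Xij]·[Xk]. -/
/-- Number of inversions of a permutation of `Fin k`. -/
def permInversions {k : ℕ} (σ : Equiv.Perm (Fin k)) : ℕ :=
  (Finset.univ.filter (fun p : Fin k × Fin k => p.1 < p.2 ∧ σ p.2 < σ p.1)).card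

/-- The quantum minor `[I|J]_q` of a matrix `x` (indexed by `ℕ`, rows/columns `1,…`),
with row set `I` and column set `J` (both listed in increasing order). -/
noncomputable def qMinor {K : Type} [Field K] {A : Type} [Ring A] [Algebra K A]
    (q : K) (x : ℕ → ℕ → A) (I J : Finset ℕ) : A :=
  if h : I.card = J.card then
    ∑ σ : Equiv.Perm (Fin I.card),
      ((-q) ^ permInversions σ) •
        (List.ofFn (fun d : Fin I.card =>
          x (I.orderEmbOfFin rfl d) (J.orderEmbOfFin h.symm (σ d)))).prod
  else 0

/-- The flag quantum minor `[J]_q := [{1,…,|J|} | J]_q`. -/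
noncomputable def flagMinor {K : Type} [Field K] {A : Type} [Ring A] [Algebra K A]
    (q : K) (x : ℕ → ℕ → A) (J : Finset ℕ) : A :=
  qMinor q x (Finset.Icc 1 J.card) J

/-- Manin's relations: `x` is an `m × n` `q`-matrix. -/
def IsQMatrix {K : Type} [Field K] {A : Type} [Ring A] [Algebra K A]
    (q : K) (m n : ℕ) (x : ℕ → ℕ → A) : Prop :=
  (∀ i j k, 1 ≤ i → i ≤ m → 1 ≤ j → j < k → k ≤ n →
    x i j * x i k = q • (x i k * x i j)) ∧
  (∀ i l j, 1 ≤ i → i < l → l ≤ m → 1 ≤ j → j ≤ n →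
    x i j * x l j = q • (x l j * x i j)) ∧
  (∀ i l j k, 1 ≤ i → i < l → l ≤ m → 1 ≤ j → j < k → k ≤ n →
    x i k * x l j = x l j * x i k) ∧
  (∀ i l j k, 1 ≤ i → i < l → l ≤ m → 1 ≤ j → j < k → k ≤ n →
    x i j * x l k - x l k * x i j = (q - q⁻¹) • (x i k * x l j))

open Finset MulOpposite OrderDual

section Manin

variable {K A α β : Type*} [Field K] [Ring A] [Algebra K A] [LinearOrder α] [LinearOrder β]

/-- Manin's relations for a matrix whose rows and columns are indexed by linear orders. -/
structure IsManin (q : K) (x : α → β → A) : Prop where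
  row : ∀ r {c d}, c < d → x r c * x r d = q • (x r d * x r c)
  col : ∀ {r s} c, r < s → x r c * x s c = q • (x s c * x r c)
  comm : ∀ {r s c d}, r < s → c < d → x r d * x s c = x s c * x r d
  cross : ∀ {r s c d}, r < s → c < d →
    x r c * x s d - x s d * x r c = (q - q⁻¹) • (x r d * x s c)

/-- The quantum minor with an arbitrary list of rows, expanded along its first row. -/
noncomputable def listMinor (q : K) (x : α → β → A) : List α → Finset β → A
  | [], J => if J = ∅ then 1 else 0
  | r :: rs, J =>
      ∑ c ∈ J, (-q) ^ #{d ∈ J | d < c} • (x r c * listMinor q x rs (J.erase c))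

/-- The quantum minor with row set `R` and column set `J`. -/
noncomputable def setMinor (q : K) (x : α → β → A) (R : Finset α) (J : Finset β) : A :=
  listMinor q x R.sort J

theorem setMinor_empty (q : K) (x : α → β → A) (J : Finset β) :
    setMinor q x ∅ J = if J = ∅ then 1 else 0 := by
  simp [setMinor, listMinor]

theorem sort_insert_of_lt {r : α} {R : Finset α} (h : ∀ s ∈ R, r < s) :
    (insert r R).sort = r :: R.sort :=
  Finset.sort_insert (r := (· ≤ ·)) (fun s hs => (h s hs).le) (fun hr => (h r hr).false)

theorem setMinor_insert (q : K) (x : α → β → A) {r : α} {R : Finset α} (h : ∀ s ∈ R, r < s)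
    (J : Finset β) :
    setMinor q x (insert r R) J =
      ∑ c ∈ J, (-q) ^ #{d ∈ J | d < c} • (x r c * setMinor q x R (J.erase c)) := by
  simp [setMinor, sort_insert_of_lt h, listMinor]

omit [LinearOrder α] in
theorem listMinor_eq_zero (q : K) (x : α → β → A) {rs : List α} {J : Finset β}
    (h : rs.length ≠ #J) : listMinor q x rs J = 0 := by
  induction rs generalizing J with
  | nil => rw [listMinor, if_neg]; rintro rfl; simp at h
  | cons r rs ih =>
    refine sum_eq_zero fun c hc => ?_
    rw [ih, mul_zero, smul_zero]
    have := card_erase_add_one hc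
    simp only [List.length_cons] at h
    lia

theorem setMinor_eq_zero (q : K) (x : α → β → A) {R : Finset α} {J : Finset β}
    (h : #R ≠ #J) : setMinor q x R J = 0 :=
  listMinor_eq_zero q x (by simpa using h)

theorem setMinor_congr (q : K) {x y : α → β → A} {R : Finset α} {J : Finset β}
    (h : ∀ r ∈ R, ∀ c ∈ J, x r c = y r c) : setMinor q x R J = setMinor q y R J := by
  induction R using Finset.induction_on_min generalizing J with
  | empty => rw [setMinor_empty, setMinor_empty]
  | insert t R ht ih =>
    rw [setMinor_insert q x ht, setMinor_insert q y ht]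
    refine sum_congr rfl fun c hc => ?_
    rw [h t (mem_insert_self _ _) c hc,
      ih fun r hr d hd => h r (mem_insert_of_mem hr) d (mem_of_mem_erase hd)]

theorem sum_sum_erase {M : Type*} [AddCommMonoid M] (J : Finset β) (f : β → β → M) :
    ∑ c ∈ J, ∑ d ∈ J.erase c, f c d = ∑ c ∈ J, ∑ d ∈ J with c < d, (f c d + f d c) := by
  simp_rw [sum_add_distrib]
  have h : ∑ c ∈ J, ∑ d ∈ J with c < d, f d c = ∑ c ∈ J, ∑ d ∈ J with d < c, f c d :=
    sum_comm' (by simp; tauto)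
  rw [h, ← sum_add_distrib]
  refine sum_congr rfl fun c _ => ?_
  rw [← sum_union (disjoint_filter.2 fun d _ h h' => (h.trans h').false), ← filter_or]
  refine sum_congr ?_ fun _ _ => rfl
  ext d
  simp [and_comm, eq_comm, ← lt_or_lt_iff_ne]

theorem card_erase_filter_lt {J : Finset β} {c d : β} (hc : c ∈ J) (h : c < d) :
    #{e ∈ J.erase c | e < d} + 1 = #{e ∈ J | e < d} := by
  rw [filter_erase, card_erase_add_one (by simp [hc, h])]

theorem erase_filter_lt_of_le {J : Finset β} {c d : β} (h : c ≤ d) :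
    {e ∈ J.erase d | e < c} = {e ∈ J | e < c} := by
  rw [filter_erase, erase_eq_of_notMem (by simp [h])]

omit [LinearOrder α] in
theorem listMinor_cons_cons (q : K) (x : α → β → A) (r s : α) (rs : List α) (J : Finset β) :
    listMinor q x (r :: s :: rs) J = ∑ c ∈ J, ∑ d ∈ J with c < d,
      (-q) ^ (#{e ∈ J | e < c} + #{e ∈ J.erase c | e < d}) •
        ((x r c * x s d + (-q) • (x r d * x s c)) *
          listMinor q x rs ((J.erase c).erase d)) := by
  simp only [listMinor, mul_sum, smul_sum]
  rw [sum_sum_erase]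
  refine sum_congr rfl fun c hc => sum_congr rfl fun d hd => ?_
  obtain ⟨hd, hcd⟩ := mem_filter.1 hd
  rw [← card_erase_filter_lt hc hcd, erase_filter_lt_of_le hcd.le, erase_right_comm (a := d)]
  simp only [mul_smul_comm, smul_smul, add_mul, smul_add, smul_mul_assoc, mul_assoc]
  congr 2 <;> ring

variable {q : K} {x : α → β → A}

theorem IsManin.listMinor_same (hx : IsManin q x) (r : α) (rs : List α) (J : Finset β) :
    listMinor q x (r :: r :: rs) J = 0 := by
  rw [listMinor_cons_cons]
  refine sum_eq_zero fun c _ => sum_eq_zero fun d hd => ?_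
  rw [hx.row r (mem_filter.1 hd).2]
  simp

theorem IsManin.listMinor_swap (hx : IsManin q x) (hq : q ≠ 0) {r s : α} (h : s < r)
    (rs : List α) (J : Finset β) :
    listMinor q x (r :: s :: rs) J = (-q) • listMinor q x (s :: r :: rs) J := by
  simp only [listMinor_cons_cons, smul_sum]
  refine sum_congr rfl fun c _ => sum_congr rfl fun d hd => ?_
  have hcd := (mem_filter.1 hd).2
  have key : x r c * x s d + (-q) • (x r d * x s c) =
      (-q) • (x s c * x r d + (-q) • (x s d * x r c)) := by
    rw [← hx.comm h hcd, sub_eq_iff_eq_add.1 (hx.cross h hcd)]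
    match_scalars <;> field_simp <;> ring
  rw [key, smul_mul_assoc, smul_comm]

/-- Laplace expansion along a row placed in front of the others. -/
theorem IsManin.row_expansion (hx : IsManin q x) (hq : q ≠ 0) (r : α) (R : Finset α)
    (J : Finset β) :
    ∑ c ∈ J, (-q) ^ #{d ∈ J | d < c} • (x r c * setMinor q x R (J.erase c)) =
      if r ∈ R then 0 else (-q) ^ #{s ∈ R | s < r} • setMinor q x (insert r R) J := by
  change listMinor q x (r :: R.sort) J = _
  induction R using Finset.induction_on_min generalizing J with
  | empty => simp [setMinor]
  | insert s R hs ih =>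
    have hsR : s ∉ R := fun h => (hs s h).false
    rw [sort_insert_of_lt hs]
    rcases lt_trichotomy r s with h | rfl | h
    · have hlt : ∀ t ∈ insert s R, r < t := by
        simpa [h] using fun t ht => h.trans (hs t ht)
      rw [if_neg fun hr => (hlt r hr).false, filter_false_of_mem fun t ht => (hlt t ht).le.not_gt]
      simp [setMinor, sort_insert_of_lt hlt, sort_insert_of_lt hs]
    · simp [hx.listMinor_same]
    · rw [hx.listMinor_swap hq h, listMinor]
      simp_rw [ih]
      by_cases hr : r ∈ R
      · simp [hr]
      · have hlt : ∀ t ∈ insert r R, s < t := by simpa [h] using hs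
        rw [if_neg (by simp [hr, h.ne']), Finset.insert_comm, setMinor_insert q x hlt,
          filter_insert, if_pos h, card_insert_of_notMem (by simp [hsR])]
        simp only [hr, if_false, smul_sum, mul_smul_comm, smul_smul]
        refine sum_congr rfl fun c _ => ?_
        congr 1; ring

theorem IsManin.commute_setMinor_of_lt (hx : IsManin q x) {r : α} {s : β} (R : Finset α)
    (J : Finset β) (hR : ∀ t ∈ R, r < t) (hJ : ∀ c ∈ J, c < s) :
    Commute (x r s) (setMinor q x R J) := by
  induction R using Finset.induction_on_min generalizing J with
  | empty => rw [setMinor_empty]; split_ifs <;> simp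
  | insert t R ht ih =>
    rw [setMinor_insert q x ht]
    refine Commute.sum_right _ _ _ fun c hc => Commute.smul_right (Commute.mul_right ?_ ?_) _
    · exact hx.comm (hR t (mem_insert_self _ _)) (hJ c hc)
    · exact ih _ (fun u hu => hR u (mem_insert_of_mem hu)) fun d hd => hJ d (mem_of_mem_erase hd)

/-- Laplace expansion along the last column. -/
theorem IsManin.last_column_expansion (hx : IsManin q x) (R : Finset α) {D : Finset β} {s : β}
    (hs : ∀ c ∈ D, c < s) :
    ∑ r ∈ R, (-q) ^ #{t ∈ R | r < t} • (setMinor q x (R.erase r) D * x r s) =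
      setMinor q x R (insert s D) := by
  have hsD : s ∉ D := fun h => (hs s h).false
  induction R using Finset.induction_on_min generalizing D with
  | empty => simp [setMinor_empty]
  | insert r R hr ih =>
    have hrR : r ∉ R := fun h => (hr r h).false
    rw [setMinor_insert q x hr, sum_insert hsD, sum_insert hrR, erase_insert hrR,
      erase_insert hsD, (hx.commute_setMinor_of_lt R D hr hs).eq]
    congr 1
    · by_cases hc : #R = #D
      · rw [filter_insert, filter_insert, if_neg (lt_irrefl _), if_neg (lt_irrefl _),
          filter_true_of_mem hr, filter_true_of_mem hs, hc]
      · simp [setMinor_eq_zero q x hc]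
    · have expand : ∀ t ∈ R, (-q) ^ #{u ∈ insert r R | t < u} •
          (setMinor q x ((insert r R).erase t) D * x t s) =
          ∑ c ∈ D, (-q) ^ #{d ∈ D | d < c} • (x r c * ((-q) ^ #{u ∈ R | t < u} •
            (setMinor q x (R.erase t) (D.erase c) * x t s))) := fun t ht => by
        rw [erase_insert_of_ne (hr t ht).ne,
          setMinor_insert q x fun u hu => hr u (mem_of_mem_erase hu),
          filter_insert, if_neg (hr t ht).not_gt, sum_mul, smul_sum]
        refine sum_congr rfl fun c _ => ?_
        rw [mul_smul_comm, smul_mul_assoc, mul_assoc, smul_comm]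
      rw [sum_congr rfl expand, sum_comm]
      refine sum_congr rfl fun c hc => ?_
      rw [← smul_sum, ← mul_sum, ih (fun d hd => hs d (mem_of_mem_erase hd)) (by simp [hsD]),
        erase_insert_of_ne (hs c hc).ne', filter_insert, if_neg (hs c hc).not_gt]

/-- The transpose of `x` over the opposite algebra, with both orders reversed. -/
def revTranspose (x : α → β → A) : βᵒᵈ → αᵒᵈ → Aᵐᵒᵖ :=
  fun c r => op (x (ofDual r) (ofDual c))

theorem IsManin.revTranspose (hx : IsManin q x) : IsManin q (revTranspose x) where
  row c r s h := congrArg op (hx.col (ofDual c) (ofDual_lt_ofDual.2 h))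
  col r h := congrArg op (hx.row (ofDual r) (ofDual_lt_ofDual.2 h))
  comm h h' := congrArg op (hx.comm (ofDual_lt_ofDual.2 h') (ofDual_lt_ofDual.2 h)).symm
  cross h h' := by
    have := congrArg op (hx.cross (ofDual_lt_ofDual.2 h') (ofDual_lt_ofDual.2 h))
    rw [hx.comm (ofDual_lt_ofDual.2 h') (ofDual_lt_ofDual.2 h)] at this
    exact this

theorem card_filter_map_toDual (R : Finset α) (r : αᵒᵈ) :
    #{s ∈ R.map toDual.toEmbedding | s < r} = #{s ∈ R | ofDual r < s} := by
  rw [filter_map, card_map]; rfl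

theorem IsManin.setMinor_revTranspose (hx : IsManin q x) (R : Finset α) (D : Finset β) :
    setMinor q (_root_.revTranspose x) (D.map toDual.toEmbedding) (R.map toDual.toEmbedding) =
      op (setMinor q x R D) := by
  induction D using Finset.induction_on_max generalizing R with
  | empty =>
    rw [map_empty, setMinor_empty]
    by_cases hR : R = ∅
    · simp [hR, setMinor_empty]
    · rw [setMinor_eq_zero q x (by simpa using hR)]; simp [hR]
  | insert s D hs ih =>
    rw [map_insert, setMinor_insert q _ (by simpa using hs), sum_map,
      ← hx.last_column_expansion R hs, op_sum]
    refine sum_congr rfl fun r _ => ?_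
    rw [← map_erase, ih, card_filter_map_toDual, op_smul, op_mul]
    rfl

/-- Laplace expansion along a column placed behind the others. -/
theorem IsManin.column_expansion (hx : IsManin q x) (hq : q ≠ 0) (s : β) (R : Finset α)
    (D : Finset β) :
    ∑ r ∈ R, (-q) ^ #{t ∈ R | r < t} • (setMinor q x (R.erase r) D * x r s) =
      if s ∈ D then 0 else (-q) ^ #{c ∈ D | s < c} • setMinor q x R (insert s D) := by
  have h := hx.revTranspose.row_expansion hq (toDual s) (D.map toDual.toEmbedding)
    (R.map toDual.toEmbedding)
  rw [sum_map] at h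
  simp_rw [← toDual.coe_toEmbedding, ← map_erase, ← map_insert, hx.setMinor_revTranspose,
    card_filter_map_toDual, mem_map'] at h
  apply op_injective
  rw [op_sum, apply_ite op, op_zero, op_smul]
  exact h

variable {R : Finset α} {J : Finset β}

theorem card_filter_lt_add_card_filter_gt {r : α} (hr : r ∈ R) :
    #{t ∈ R | t < r} + #{t ∈ R | r < t} + 1 = #R := by
  rw [← card_union_of_disjoint (disjoint_filter.2 fun t _ h h' => (h.trans h').false),
    ← filter_or, ← card_erase_add_one hr]
  congr 2
  ext t
  simp [lt_or_lt_iff_ne, and_comm]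

theorem IsManin.sum_mul_setMinor_mul (hx : IsManin q x) (hq : q ≠ 0) {r : α} (hr : r ∈ R)
    (s : β) :
    ∑ c ∈ J, (-q) ^ #{d ∈ J | d < c} • (x r c * if s ∈ J.erase c then 0 else
      (-q) ^ #{d ∈ J.erase c | s < d} • setMinor q x R (insert s (J.erase c))) =
    (-q) ^ (#R - 1) • (setMinor q x R J * x r s) := by
  simp_rw [← hx.column_expansion hq, mul_sum, smul_sum]
  rw [sum_comm, sum_eq_single_of_mem r hr]
  · have h := congrArg (fun y => (-q) ^ #{t ∈ R | r < t} • (y * x r s))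
      (hx.row_expansion hq r (R.erase r) J)
    simp only [notMem_erase, if_false, insert_erase hr, erase_filter_lt_of_le le_rfl, sum_mul,
      smul_sum, smul_mul_assoc, smul_smul] at h
    rw [← card_filter_lt_add_card_filter_gt hr, Nat.add_sub_cancel, add_comm, pow_add, ← h]
    refine sum_congr rfl fun c _ => ?_
    rw [mul_smul_comm, smul_smul, mul_comm, mul_assoc]
  · intro t _ htr
    have h := congrArg (fun y => (-q) ^ #{u ∈ R | t < u} • (y * x t s))
      (hx.row_expansion hq r (R.erase t) J)
    simp only [mem_erase, ne_eq, htr.symm, not_false_iff, hr, and_self, if_true, sum_mul,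
      smul_sum, smul_mul_assoc, smul_smul, zero_mul, smul_zero] at h
    rw [← h]
    refine sum_congr rfl fun c _ => ?_
    rw [mul_smul_comm, smul_smul, mul_comm, mul_assoc]

/-- An entry of a square `q`-matrix commutes with its quantum determinant. -/
theorem IsManin.commute_setMinor (hx : IsManin q x) (hq : q ≠ 0) {r : α} (hr : r ∈ R)
    {s : β} (hs : s ∈ J) (hRJ : #R = #J) : Commute (setMinor q x R J) (x r s) := by
  have h := hx.sum_mul_setMinor_mul (J := J) hq hr s
  rw [sum_eq_single_of_mem s hs fun c _ hcs => by simp [hcs.symm, hs], if_neg (notMem_erase _ _),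
    insert_erase hs, mul_smul_comm, smul_smul, ← pow_add] at h
  have hcard := card_filter_lt_add_card_filter_gt hs
  have hgt : #{d ∈ J.erase s | s < d} = #{d ∈ J | s < d} := by
    rw [filter_erase, erase_eq_of_notMem (by simp)]
  rw [hgt, hRJ, ← hcard, Nat.add_sub_cancel] at h
  exact (smul_right_injective A (pow_ne_zero _ (neg_ne_zero.2 hq)) h).symm

theorem IsManin.commute_setMinor_setMinor (hx : IsManin q x) (hq : q ≠ 0) {R' : Finset α}
    {J' : Finset β} (hR : R' ⊆ R) (hJ : J' ⊆ J) (hRJ : #R = #J) :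
    Commute (setMinor q x R J) (setMinor q x R' J') := by
  induction R' using Finset.induction_on_min generalizing J' with
  | empty => rw [setMinor_empty]; split_ifs <;> simp
  | insert t R' ht ih =>
    rw [setMinor_insert q x ht]
    refine Commute.sum_right _ _ _ fun c hc => Commute.smul_right (Commute.mul_right ?_ ?_) _
    · exact hx.commute_setMinor hq (hR (mem_insert_self _ _)) (hJ hc) hRJ
    · exact ih ((subset_insert _ _).trans hR) ((erase_subset _ _).trans hJ)


theorem IsManin.sum_setMinor_mul_sum (hx : IsManin q x) (hq : q ≠ 0) (D : Finset β)
    (a : β → K) (M : β → A) :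
    ∑ r ∈ R, (-q) ^ #{t ∈ R | r < t} •
        (setMinor q x (R.erase r) D * ∑ c ∈ J, a c • (x r c * M c)) =
      ∑ c ∈ J \ D, (a c * (-q) ^ #{d ∈ D | c < d}) • (setMinor q x R (insert c D) * M c) := by
  simp_rw [mul_sum, smul_sum]
  rw [sum_comm, sdiff_eq_filter, sum_filter]
  refine sum_congr rfl fun c _ => ?_
  have h := congrArg (fun y => a c • (y * M c)) (hx.column_expansion hq c R D)
  simp only [sum_mul, smul_sum] at h
  rw [ite_not]
  split_ifs at h ⊢
  · rw [zero_mul, smul_zero] at h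
    rw [← h]
    refine sum_congr rfl fun r _ => ?_
    rw [mul_smul_comm, smul_mul_assoc, smul_comm, mul_assoc]
  · rw [mul_smul, ← smul_mul_assoc, ← h]
    refine sum_congr rfl fun r _ => ?_
    rw [mul_smul_comm, smul_mul_assoc, smul_comm, mul_assoc]

variable {R' : Finset α} {D : Finset β}

theorem IsManin.plucker_relation (hx : IsManin q x) (hq : q ≠ 0) (hR : R' ⊆ R) :
    ∑ c ∈ J \ D, ((-q) ^ #{d ∈ J | d < c} * (-q) ^ #{d ∈ D | c < d}) •
      (setMinor q x R' (insert c D) * setMinor q x R (J.erase c)) = 0 := by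
  rw [← hx.sum_setMinor_mul_sum hq D (fun c => (-q) ^ #{d ∈ J | d < c})
    (fun c => setMinor q x R (J.erase c))]
  refine sum_eq_zero fun r hr => ?_
  rw [hx.row_expansion hq, if_pos (hR hr), mul_zero, smul_zero]

theorem IsManin.exchange_relation (hx : IsManin q x) (hq : q ≠ 0) (hR : R' ⊆ R) (hD : D ⊆ J)
    (hRJ : #R = #J) {s : β} (hs : s ∉ J) :
    ((-q) ^ (#R - 1) * (-q) ^ #{d ∈ D | s < d}) •
        (setMinor q x R J * setMinor q x R' (insert s D)) =
      ∑ c ∈ J \ D, ((-q) ^ (#{d ∈ J | d < c} + #{d ∈ J.erase c | s < d}) *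
        (-q) ^ #{d ∈ D | c < d}) •
          (setMinor q x R' (insert c D) * setMinor q x R (insert s (J.erase c))) := by
  rw [← hx.sum_setMinor_mul_sum hq D
    (fun c => (-q) ^ (#{d ∈ J | d < c} + #{d ∈ J.erase c | s < d}))
    (fun c => setMinor q x R (insert s (J.erase c)))]
  have h := hx.column_expansion hq s R' D
  rw [if_neg fun h => hs (hD h)] at h
  rw [mul_smul, ← mul_smul_comm, ← h, mul_sum, smul_sum]
  refine sum_congr rfl fun r hr => ?_
  have h' := hx.sum_mul_setMinor_mul (J := J) hq (hR hr) s
  simp only [fun c => mt (mem_of_mem_erase (a := c)) hs, if_false, mul_smul_comm, smul_smul,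
    ← pow_add] at h'
  rw [h', mul_smul_comm, mul_smul_comm, ← mul_assoc,
    (hx.commute_setMinor_setMinor hq ((erase_subset r R').trans hR) hD hRJ).eq, mul_assoc,
    smul_comm]

theorem IsManin.setMinor_mul_setMinor (hx : IsManin q x) (hq : q ≠ 0) (hR : R' ⊆ R)
    {X : Finset β} (hRX : #R = #X + 2) {i j k : β} (hij : i < j) (hjk : j < k)
    (hi : i ∉ X) (hj : j ∉ X) (hk : k ∉ X) :
    setMinor q x R (insert i (insert k X)) * setMinor q x R' (insert j X) =
      q • (setMinor q x R' (insert j X) * setMinor q x R (insert i (insert k X))) -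
        (q - q⁻¹) •
          (setMinor q x R (insert i (insert j X)) * setMinor q x R' (insert k X)) := by
  have hik := hij.trans hjk
  have hu : -q ≠ 0 := neg_ne_zero.2 hq
  have card {c : β} (hc : c ∉ X) : #{d ∈ X | d < c} + #{d ∈ X | c < d} = #X := by
    have h := card_filter_lt_add_card_filter_gt (mem_insert_self c X)
    simpa [filter_insert, card_insert_of_notMem hc] using h
  have sdiff_pair {a b : β} (ha : a ∉ X) (hb : b ∉ X) :
      insert a (insert b X) \ X = {a, b} := by
    ext c; simp only [mem_sdiff, mem_insert, mem_singleton]; grind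
  have sdiff_triple : insert i (insert j (insert k X)) \ X = {i, j, k} := by
    ext c; simp only [mem_sdiff, mem_insert, mem_singleton]; grind
  have erase_j : (insert i (insert j (insert k X))).erase j = insert i (insert k X) := by grind
  have erase_k : (insert i (insert j (insert k X))).erase k = insert i (insert j X) := by grind
  have erase_i : (insert i (insert j (insert k X))).erase i = insert j (insert k X) := by grind
  have erase_ik : (insert i (insert k X)).erase k = insert i X := by grind
  have erase_ij : (insert i (insert j X)).erase j = insert i X := by grind
  have P := hx.plucker_relation (J := insert i (insert j (insert k X))) (D := X) hq hR
  have Ej := hx.exchange_relation (J := insert i (insert k X)) (D := X) (s := j) hq hR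
    (by grind) (by grind) (by grind)
  have Ek := hx.exchange_relation (J := insert i (insert j X)) (D := X) (s := k) hq hR
    (by grind) (by grind) (by grind)
  rw [sdiff_triple, sum_insert (by grind), sum_insert (by grind), sum_singleton, erase_i, erase_j,
    erase_k] at P
  rw [sdiff_pair hi hk, sum_pair hik.ne] at Ej
  rw [sdiff_pair hi hj, sum_pair hij.ne] at Ek
  rw [erase_ik, erase_insert (by grind), Finset.insert_comm j i X] at Ej
  rw [erase_ij, erase_insert (by grind), Finset.insert_comm k i X, Finset.insert_comm k j X] at Ek
  simp only [filter_insert, hij, hjk, hik, hij.not_gt, hjk.not_gt, hik.not_gt, lt_irrefl, if_true,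
    if_false, mem_filter, hi, hj, hk, hij.ne, mem_insert, false_and, or_false,
    not_false_eq_true, card_insert_of_notMem, hRX,
    Nat.succ_sub_one] at P Ej Ek
  have pow_i := congrArg ((-q) ^ ·) (card hi)
  have pow_j := congrArg ((-q) ^ ·) (card hj)
  have pow_k := congrArg ((-q) ^ ·) (card hk)
  generalize hu' : -q = u at P Ej Ek pow_i pow_j pow_k hu
  simp only [pow_add] at pow_i pow_j pow_k
  generalize setMinor q x R (insert i (insert k X)) = Mj at *
  generalize setMinor q x R (insert i (insert j X)) = Mk at *
  generalize setMinor q x R (insert j (insert k X)) = Mi at *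
  generalize setMinor q x R' (insert i X) = Ni at *
  generalize setMinor q x R' (insert j X) = Nj at *
  generalize setMinor q x R' (insert k X) = Nk at *
  have P' : Ni * Mi + u • (Nj * Mj) + u ^ 2 • (Nk * Mk) = 0 := by
    apply smul_right_injective A (pow_ne_zero #X hu)
    linear_combination (norm := skip) P
    match_scalars
    · linear_combination -pow_i
    · linear_combination -u * pow_j
    · linear_combination -u ^ 2 * pow_k
  have Ej' : Mj * Nj = Ni * Mi + Nk * Mk := by
    apply smul_right_injective A (mul_ne_zero (pow_ne_zero (#X + 1) hu)
      (pow_ne_zero #{d ∈ X | j < d} hu))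
    linear_combination (norm := skip) Ej
    match_scalars
    · ring
    · linear_combination u * u ^ #{d ∈ X | j < d} * pow_i
    · linear_combination u * u ^ #{d ∈ X | j < d} * pow_k
  have Ek' : u • (Mk * Nk) = Ni * Mi + u • (Nj * Mj) := by
    apply smul_right_injective A (mul_ne_zero (pow_ne_zero #X hu)
      (pow_ne_zero #{d ∈ X | k < d} hu))
    linear_combination (norm := skip) Ek
    match_scalars
    · ring
    · linear_combination u ^ #{d ∈ X | k < d} * pow_i
    · linear_combination u * u ^ #{d ∈ X | k < d} * pow_j
  subst hu'
  linear_combination (norm := skip) Ej' - ((q - q⁻¹) / q) • Ek' + q⁻¹ ^ 2 • P'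
  match_scalars <;> field_simp <;> ring

end Manin

section Leibniz

variable {K A α : Type*} [Field K] [Ring A] [Algebra K A]

theorem permInversions_eq_sum {k : ℕ} (σ : Equiv.Perm (Fin k)) :
    permInversions σ = ∑ a, ∑ b, if a < b ∧ σ b < σ a then 1 else 0 := by
  rw [permInversions, card_filter, Fintype.sum_prod_type]

theorem card_filter_fin_lt {k : ℕ} (p : Fin k) : #{a | a < p} = (p : ℕ) := by
  rw [← Fin.card_Iio p]
  congr 1
  ext
  simp

/-- The permutation sending `0` to `p` and inducing `τ` on the remaining elements. -/
def consPerm {k : ℕ} (p : Fin (k + 1)) (τ : Equiv.Perm (Fin k)) : Equiv.Perm (Fin (k + 1)) :=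
  (finSuccEquiv k).trans ((Equiv.optionCongr τ).trans (finSuccEquiv' p).symm)

@[simp] theorem consPerm_zero {k : ℕ} (p : Fin (k + 1)) (τ : Equiv.Perm (Fin k)) :
    consPerm p τ 0 = p := by
  simp [consPerm]

@[simp] theorem consPerm_succ {k : ℕ} (p : Fin (k + 1)) (τ : Equiv.Perm (Fin k)) (a : Fin k) :
    consPerm p τ a.succ = p.succAbove (τ a) := by
  simp [consPerm]

theorem consPerm_bijective (k : ℕ) :
    Function.Bijective fun a : Fin (k + 1) × Equiv.Perm (Fin k) => consPerm a.1 a.2 := by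
  rw [Fintype.bijective_iff_injective_and_card]
  constructor
  · rintro ⟨p, τ⟩ ⟨p', τ'⟩ h
    obtain rfl : p = p' := by simpa using DFunLike.congr_fun h 0
    have : τ = τ' := Equiv.ext fun a => by simpa using DFunLike.congr_fun h a.succ
    rw [this]
  · simp [Fintype.card_perm, Nat.factorial_succ]

theorem permInversions_consPerm {k : ℕ} (p : Fin (k + 1)) (τ : Equiv.Perm (Fin k)) :
    permInversions (consPerm p τ) = p + permInversions τ := by
  have h : ∑ b, (if p.succAbove (τ b) < p then 1 else 0) = (p : ℕ) := by
    rw [Equiv.sum_comp τ fun b => if p.succAbove b < p then 1 else 0]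
    have h := Fin.sum_univ_succAbove (fun b => if b < p then 1 else 0) p
    rw [if_neg (lt_irrefl p), zero_add] at h
    rw [← h, ← card_filter]
    exact card_filter_fin_lt p
  simp only [permInversions_eq_sum, Fin.sum_univ_succ, consPerm_zero, consPerm_succ,
    Fin.succ_pos, Fin.succ_lt_succ_iff, Fin.not_lt_zero, false_and, true_and, if_false, zero_add, h,
    Fin.succAbove_lt_succAbove_iff]

theorem sum_eq_sum_orderEmbOfFin {M : Type*} [AddCommMonoid M] {k : ℕ} (J : Finset ℕ)
    (hJ : #J = k) (f : ℕ → M) : ∑ c ∈ J, f c = ∑ p, f (J.orderEmbOfFin hJ p) := by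
  conv_lhs => rw [← J.map_orderEmbOfFin_univ hJ, sum_map]
  rfl

theorem sum_perm_eq_listMinor (q : K) (x : α → ℕ → A) {k : ℕ} (r : Fin k → α) (J : Finset ℕ)
    (hJ : #J = k) :
    ∑ σ : Equiv.Perm (Fin k), (-q) ^ permInversions σ •
      (List.ofFn fun d => x (r d) (J.orderEmbOfFin hJ (σ d))).prod =
    listMinor q x (List.ofFn r) J := by
  induction k generalizing J with
  | zero =>
    obtain rfl := card_eq_zero.1 hJ
    simp [listMinor, permInversions]
  | succ k ih =>
    rw [← (consPerm_bijective k).sum_comp, Fintype.sum_prod_type, List.ofFn_succ, listMinor,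
      sum_eq_sum_orderEmbOfFin J hJ]
    refine sum_congr rfl fun p _ => ?_
    have hp : J.orderEmbOfFin hJ p ∈ J := J.orderEmbOfFin_mem hJ p
    have hc : #(J.erase (J.orderEmbOfFin hJ p)) = k := by rw [card_erase_of_mem hp, hJ]; rfl
    have he (a : Fin k) : (J.erase (J.orderEmbOfFin hJ p)).orderEmbOfFin hc a =
        J.orderEmbOfFin hJ (p.succAbove a) := by
      refine (DFunLike.congr_fun (orderEmbOfFin_unique' hc
        (f := (Fin.succAboveOrderEmb p).trans (J.orderEmbOfFin hJ)) fun a => ?_) a).symm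
      simp
    have hcard : #{d ∈ J | d < J.orderEmbOfFin hJ p} = p := by
      have hmap := J.map_orderEmbOfFin_univ hJ
      generalize J.orderEmbOfFin hJ = f at hmap
      rw [← hmap, filter_map, card_map]
      simpa using card_filter_fin_lt p
    rw [hcard, ← ih (fun a => r a.succ) _ hc, mul_sum, smul_sum]
    refine sum_congr rfl fun τ _ => ?_
    simp [permInversions_consPerm, he, pow_add, mul_smul]

theorem qMinor_eq_setMinor {K A : Type} [Field K] [Ring A] [Algebra K A] (q : K)
    (x : ℕ → ℕ → A) {I J : Finset ℕ} (h : #I = #J) : qMinor q x I J = setMinor q x I J := by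
  rw [qMinor, dif_pos h, sum_perm_eq_listMinor q x (I.orderEmbOfFin rfl) J h.symm, setMinor]
  rw [List.ofFn_eq_map, listMap_orderEmbOfFin_finRange]

theorem flagMinor_eq_setMinor {K A : Type} [Field K] [Ring A] [Algebra K A] (q : K)
    (x : ℕ → ℕ → A) (J : Finset ℕ) : flagMinor q x J = setMinor q x (Icc 1 #J) J :=
  qMinor_eq_setMinor q x (by simp)

end Leibniz

section ZeroExtend

variable {K A : Type} [Field K] [Ring A] [Algebra K A]

/-- The matrix agreeing with `x` on its first `m` rows and `n` columns and zero elsewhere. -/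
def zeroExtend (m n : ℕ) (x : ℕ → ℕ → A) (r c : ℕ) : A :=
  if r ∈ Icc 1 m ∧ c ∈ Icc 1 n then x r c else 0

theorem isManin_zeroExtend {q : K} {m n : ℕ} {x : ℕ → ℕ → A} (hx : IsQMatrix q m n x) :
    IsManin q (zeroExtend m n x) := by
  obtain ⟨row, col, comm, cross⟩ := hx
  constructor
  · intro r c d h
    by_cases hr : r ∈ Icc 1 m <;> by_cases hc : c ∈ Icc 1 n <;> by_cases hd : d ∈ Icc 1 n <;>
      simp only [zeroExtend, hr, hc, hd, and_true, and_false, if_true, if_false, mul_zero,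
        zero_mul, smul_zero]
    rw [mem_Icc] at hr hc hd
    exact row r c d hr.1 hr.2 hc.1 h hd.2
  · intro r s c h
    by_cases hr : r ∈ Icc 1 m <;> by_cases hs : s ∈ Icc 1 m <;> by_cases hc : c ∈ Icc 1 n <;>
      simp only [zeroExtend, hr, hs, hc, and_true, and_false, if_true, if_false, mul_zero,
        zero_mul, smul_zero]
    rw [mem_Icc] at hr hs hc
    exact col r s c hr.1 h hs.2 hc.1 hc.2
  · intro r s c d h h'
    by_cases hr : r ∈ Icc 1 m <;> by_cases hs : s ∈ Icc 1 m <;> by_cases hc : c ∈ Icc 1 n <;>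
      by_cases hd : d ∈ Icc 1 n <;>
      simp only [zeroExtend, hr, hs, hc, hd, and_true, and_false, if_true, if_false, mul_zero,
        zero_mul]
    rw [mem_Icc] at hr hs hc hd
    exact comm r s c d hr.1 h hs.2 hc.1 h' hd.2
  · intro r s c d h h'
    by_cases hr : r ∈ Icc 1 m <;> by_cases hs : s ∈ Icc 1 m <;> by_cases hc : c ∈ Icc 1 n <;>
      by_cases hd : d ∈ Icc 1 n <;>
      simp only [zeroExtend, hr, hs, hc, hd, and_true, and_false, if_true, if_false, mul_zero,
        zero_mul, smul_zero, sub_zero]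
    rw [mem_Icc] at hr hs hc hd
    exact cross r s c d hr.1 h hs.2 hc.1 h' hd.2

theorem setMinor_zeroExtend (q : K) {m n : ℕ} (x : ℕ → ℕ → A) {R J : Finset ℕ}
    (hR : ∀ r ∈ R, 1 ≤ r ∧ r ≤ m) (hJ : ∀ c ∈ J, 1 ≤ c ∧ c ≤ n) :
    setMinor q x R J = setMinor q (zeroExtend m n x) R J :=
  setMinor_congr q fun r hr c hc =>
    (if_pos ⟨mem_Icc.2 (hR r hr), mem_Icc.2 (hJ c hc)⟩).symm

end ZeroExtend

/-- The commutation relation `[Xik][Xj] = q[Xj][Xik] - (q - q⁻¹)[Xij][Xk]`. -/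
theorem flag_commutation_relation
    {K A : Type} [Field K] [Ring A] [Algebra K A] {m n : ℕ}
    (q : K) (hq : q ≠ 0) (x : ℕ → ℕ → A) (hx : IsQMatrix q m n x)
    (i j k : ℕ) (h1i : 1 ≤ i) (hij : i < j) (hjk : j < k) (hkn : k ≤ n)
    (X : Finset ℕ) (hXn : X ⊆ Finset.Icc 1 n)
    (hiX : i ∉ X) (hjX : j ∉ X) (hkX : k ∉ X)
    (hm : X.card + 2 ≤ m) :
    flagMinor q x (insert i (insert k X)) * flagMinor q x (insert j X) =
      q • (flagMinor q x (insert j X) * flagMinor q x (insert i (insert k X))) -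
        (q - q⁻¹) • (flagMinor q x (insert i (insert j X)) * flagMinor q x (insert k X)) := by
  have hcard {a b : ℕ} (hab : a < b) (ha : a ∉ X) (hb : b ∉ X) :
      #(insert a (insert b X)) = #X + 2 := by
    rw [card_insert_of_notMem (by simp [hab.ne, ha]), card_insert_of_notMem hb]
  have hX : ∀ c ∈ X, 1 ≤ c ∧ c ≤ n := fun c hc => mem_Icc.1 (hXn hc)
  have big {a b : ℕ} (hab : a < b) (h1a : 1 ≤ a) (hbn : b ≤ n) (ha : a ∉ X) (hb : b ∉ X) :
      flagMinor q x (insert a (insert b X)) =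
        setMinor q (zeroExtend m n x) (Icc 1 (#X + 2)) (insert a (insert b X)) := by
    rw [flagMinor_eq_setMinor, hcard hab ha hb]
    refine setMinor_zeroExtend q x (by grind) fun c hc => ?_
    grind
  have small {a : ℕ} (h1a : 1 ≤ a) (han : a ≤ n) (ha : a ∉ X) :
      flagMinor q x (insert a X) =
        setMinor q (zeroExtend m n x) (Icc 1 (#X + 1)) (insert a X) := by
    rw [flagMinor_eq_setMinor, card_insert_of_notMem ha]
    refine setMinor_zeroExtend q x (by grind) fun c hc => ?_
    grind
  rw [big (hij.trans hjk) h1i hkn hiX hkX, big hij h1i (by lia) hiX hjX,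
    small (by lia) (by lia) hjX, small (by lia) hkn hkX]
  exact (isManin_zeroExtend hx).setMinor_mul_setMinor hq (Icc_subset_Icc_right (by lia))
    (by simp) hij hjk hiX hjX hkX
end

section
/- Let K be a field, q a nonzero element of K, and x an m×n q-matrix with entries in an associative unital K-algebra A. Let 1 ≤ i < k ≤ m and X ⊆ {1,…,m} − {i,k}, let 1 ≤ i' < k' ≤ n and X' ⊆ {1,…,n} − {i',k'}, with |X'| = |X|. Then the following Dodgson-type identity holds: [Xi|X'i']·[Xk|X'k'] = q [Xi|X'k']·[Xk|X'i'] + [Xik|X'i'k']·[X|X']. -/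
section LaplaceExpansion

variable {K A : Type} [Field K] [Ring A] [Algebra K A]

/-- The coefficient of `e_J` in the product `v_{a₁} v_{a₂} ⋯` over the list `[a₁, a₂, …]`, where
`v_a = ∑ j, x a j e_j` and the `e_j` generate the quantum exterior algebra. -/
noncomputable def rowProductCoeff (q : K) (x : ℕ → ℕ → A) : List ℕ → Finset ℕ → A
  | [], J => if J = ∅ then 1 else 0
  | a :: L, J => ∑ j ∈ J,
      (-q) ^ (J.filter (· < j)).card • (x a j * rowProductCoeff q x L (J.erase j))

theorem rowProductCoeff_cons (q : K) (x : ℕ → ℕ → A) (a : ℕ) (L : List ℕ) (J : Finset ℕ) :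
    rowProductCoeff q x (a :: L) J = ∑ j ∈ J,
      (-q) ^ (J.filter (· < j)).card • (x a j * rowProductCoeff q x L (J.erase j)) := rfl

theorem sum_sum_erase_eq_sum_sum_lt {M : Type*} [AddCommMonoid M] (J : Finset ℕ)
    (F : ℕ → ℕ → M) :
    ∑ j ∈ J, ∑ k ∈ J.erase j, F j k = ∑ j ∈ J, ∑ k ∈ J.filter (j < ·), (F j k + F k j) := by
  have h : ∀ j ∈ J, ∑ k ∈ J.erase j, F j k =
      ∑ k ∈ J.filter (j < ·), F j k + ∑ k ∈ J.filter (· < j), F j k := by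
    intro j _
    rw [← Finset.sum_union]
    · refine Finset.sum_congr ?_ fun _ _ => rfl
      ext k
      simp only [Finset.mem_erase, Finset.mem_union, Finset.mem_filter]
      grind
    · rw [Finset.disjoint_left]
      intro k
      simp only [Finset.mem_filter]
      grind
  rw [Finset.sum_congr rfl h]
  simp only [Finset.sum_add_distrib]
  congr 1
  apply Finset.sum_comm'
  simp only [Finset.mem_filter]
  grind

theorem filter_lt_erase_of_le {J : Finset ℕ} {j k : ℕ} (h : j ≤ k) :
    (J.erase k).filter (· < j) = J.filter (· < j) := by
  ext
  simp only [Finset.mem_filter, Finset.mem_erase]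
  grind

theorem card_filter_lt_erase {J : Finset ℕ} {j k : ℕ} (hj : j ∈ J) (h : j < k) :
    ((J.erase j).filter (· < k)).card + 1 = (J.filter (· < k)).card := by
  rw [Finset.filter_erase, Finset.card_erase_add_one]
  simp [hj, h]

theorem filter_gt_erase_of_le {J : Finset ℕ} {j k : ℕ} (h : k ≤ j) :
    (J.erase k).filter (j < ·) = J.filter (j < ·) := by
  ext
  simp only [Finset.mem_filter, Finset.mem_erase]
  grind

theorem card_filter_gt_erase {J : Finset ℕ} {j k : ℕ} (hj : j ∈ J) (h : k < j) :
    ((J.erase j).filter (k < ·)).card + 1 = (J.filter (k < ·)).card := by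
  rw [Finset.filter_erase, Finset.card_erase_add_one]
  simp [hj, h]

theorem rowProductCoeff_cons_cons (q : K) (x : ℕ → ℕ → A) (a b : ℕ) (L : List ℕ)
    (J : Finset ℕ) :
    rowProductCoeff q x (a :: b :: L) J = ∑ j ∈ J, ∑ k ∈ J.filter (j < ·),
      (-q) ^ ((J.filter (· < j)).card + ((J.erase j).filter (· < k)).card) •
        ((x a j * x b k - q • (x a k * x b j)) *
          rowProductCoeff q x L ((J.erase j).erase k)) := by
  simp only [rowProductCoeff_cons, Finset.mul_sum, Finset.smul_sum]
  rw [sum_sum_erase_eq_sum_sum_lt]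
  refine Finset.sum_congr rfl fun j hj => Finset.sum_congr rfl fun k hk => ?_
  have hjk := (Finset.mem_filter.1 hk).2
  rw [filter_lt_erase_of_le hjk.le, ← card_filter_lt_erase hj hjk, Finset.erase_right_comm (a := k)]
  simp only [mul_smul_comm, smul_smul, sub_mul, smul_sub, smul_mul_assoc, mul_assoc]
  rw [sub_eq_add_neg, ← neg_smul]
  congr 2 <;> ring

variable {q : K} {m n : ℕ} {x : ℕ → ℕ → A}

theorem IsQMatrix.transpose (hx : IsQMatrix q m n x) : IsQMatrix q n m fun i j => x j i := by
  obtain ⟨h1, h2, h3, h4⟩ := hx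
  refine ⟨fun i j k a b c d e => h2 j k i c d e a b, fun i l j a b c d e => h1 j i l d e a b c,
    fun i l j k a b c d e f => (h3 j k i l d e f a b c).symm, fun i l j k a b c d e f => ?_⟩
  rw [← h3 j k i l d e f a b c]
  exact h4 j k i l d e f a b c

theorem rowProductCoeff_swap (hq : q ≠ 0) (hx : IsQMatrix q m n x) {a b : ℕ} (ha : 1 ≤ a)
    (hab : a < b) (hb : b ≤ m) (L : List ℕ) {J : Finset ℕ} (hJ : J ⊆ Finset.Icc 1 n) :
    rowProductCoeff q x (b :: a :: L) J = (-q) • rowProductCoeff q x (a :: b :: L) J := by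
  simp only [rowProductCoeff_cons_cons, Finset.smul_sum]
  refine Finset.sum_congr rfl fun j hj => Finset.sum_congr rfl fun k hk => ?_
  obtain ⟨hk, hjk⟩ := Finset.mem_filter.1 hk
  have h1j := (Finset.mem_Icc.1 (hJ hj)).1
  have hkn := (Finset.mem_Icc.1 (hJ hk)).2
  have h3 := hx.2.2.1 a b j k ha hab hb h1j hjk hkn
  have h4 := hx.2.2.2 a b j k ha hab hb h1j hjk hkn
  have h : x b j * x a k - q • (x b k * x a j) =
      (-q) • (x a j * x b k - q • (x a k * x b j)) := by
    rw [← h3, ← sub_sub_cancel (x a j * x b k) (x b k * x a j), h4]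
    match_scalars <;> field_simp
    ring
  rw [h, smul_mul_assoc, smul_comm]

theorem rowProductCoeff_cons_cons_self (hx : IsQMatrix q m n x) {a : ℕ} (ha : 1 ≤ a)
    (ham : a ≤ m) (L : List ℕ) {J : Finset ℕ} (hJ : J ⊆ Finset.Icc 1 n) :
    rowProductCoeff q x (a :: a :: L) J = 0 := by
  rw [rowProductCoeff_cons_cons]
  refine Finset.sum_eq_zero fun j hj => Finset.sum_eq_zero fun k hk => ?_
  obtain ⟨hk, hjk⟩ := Finset.mem_filter.1 hk
  rw [hx.1 a j k ha ham (Finset.mem_Icc.1 (hJ hj)).1 hjk (Finset.mem_Icc.1 (hJ hk)).2]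
  simp

/-- Prepending a row preserves a linear relation between two coefficients. -/
theorem rowProductCoeff_cons_congr (c : K) {a : ℕ} {L M : List ℕ} {J : Finset ℕ}
    (h : ∀ j ∈ J, rowProductCoeff q x L (J.erase j) = c • rowProductCoeff q x M (J.erase j)) :
    rowProductCoeff q x (a :: L) J = c • rowProductCoeff q x (a :: M) J := by
  simp only [rowProductCoeff_cons, Finset.smul_sum]
  refine Finset.sum_congr rfl fun j hj => ?_
  rw [h j hj, mul_smul_comm, smul_comm]

theorem rowProductCoeff_cons_of_sorted (hq : q ≠ 0) (hx : IsQMatrix q m n x) {a : ℕ} (ha : 1 ≤ a)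
    (ham : a ≤ m) (L : List ℕ) (hL : L.Pairwise (· < ·)) (hLm : ∀ b ∈ L, 1 ≤ b ∧ b ≤ m)
    (J : Finset ℕ) (hJ : J ⊆ Finset.Icc 1 n) :
    rowProductCoeff q x (a :: L) J =
      (if a ∈ L then 0 else (-q) ^ (L.filter (· < a)).length) •
        rowProductCoeff q x (L.orderedInsert (· ≤ ·) a) J := by
  induction L generalizing J with
  | nil => simp
  | cons b L ih =>
    have hL' := List.pairwise_cons.1 hL
    rcases lt_trichotomy a b with h | rfl | h
    · have h1 : a ∉ b :: L := by
        intro h'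
        rcases List.mem_cons.1 h' with h' | h'
        · omega
        · have := hL'.1 a h'
          omega
      have h2 : (b :: L).filter (· < a) = [] := by
        rw [List.filter_eq_nil_iff]
        intro c hc
        rcases List.mem_cons.1 hc with rfl | hc
        · simp [h.le]
        · have := hL'.1 c hc
          simp
          omega
      rw [if_neg h1, h2, List.orderedInsert, if_pos h.le]
      simp
    · rw [rowProductCoeff_cons_cons_self hx ha ham L hJ]
      simp
    · rw [rowProductCoeff_swap hq hx (hLm b (by simp)).1 h ham L hJ,
        rowProductCoeff_cons_congr _ fun j _ => ih hL'.2 (fun c hc => hLm c (by simp [hc]))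
          (J.erase j) ((Finset.erase_subset _ _).trans hJ),
        List.orderedInsert, if_neg h.not_ge, smul_smul]
      congr 1
      simp only [List.mem_cons, h.ne', false_or]
      rw [List.filter_cons_of_pos (by simpa using h), List.length_cons, pow_succ']
      split <;> simp

theorem rowProductCoeff_append_of_sorted (hq : q ≠ 0) (hx : IsQMatrix q m n x) {a : ℕ}
    (ha : 1 ≤ a) (ham : a ≤ m) (L : List ℕ) (hL : L.Pairwise (· < ·))
    (hLm : ∀ b ∈ L, 1 ≤ b ∧ b ≤ m) (J : Finset ℕ) (hJ : J ⊆ Finset.Icc 1 n) :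
    rowProductCoeff q x (L ++ [a]) J =
      (if a ∈ L then 0 else (-q) ^ (L.filter (a < ·)).length) •
        rowProductCoeff q x (L.orderedInsert (· ≤ ·) a) J := by
  induction L generalizing J with
  | nil => simp
  | cons b L ih =>
    have hL' := List.pairwise_cons.1 hL
    rw [List.cons_append, rowProductCoeff_cons_congr _ fun j _ => ih hL'.2
      (fun c hc => hLm c (by simp [hc])) (J.erase j) ((Finset.erase_subset _ _).trans hJ)]
    have hins : a ≤ b → L.orderedInsert (· ≤ ·) a = a :: L := by
      intro h
      cases L with
      | nil => rfl
      | cons c L =>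
        have := hL'.1 c (by simp)
        rw [List.orderedInsert, if_pos (by omega)]
    rcases lt_trichotomy a b with h | rfl | h
    · rw [hins h.le, rowProductCoeff_swap hq hx ha h (hLm b (by simp)).2 L hJ,
        List.orderedInsert, if_pos h.le, smul_smul]
      congr 1
      simp only [List.mem_cons, h.ne, false_or]
      rw [List.filter_cons_of_pos (by simpa using h), List.length_cons, pow_succ]
      split <;> simp
    · rw [hins le_rfl, rowProductCoeff_cons_cons_self hx ha ham L hJ]
      simp
    · rw [List.orderedInsert, if_neg h.not_ge]
      congr 1
      simp only [List.mem_cons, h.ne', false_or]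
      rw [List.filter_cons_of_neg (by simpa using h.le)]

theorem rowProductCoeff_append (q : K) (x : ℕ → ℕ → A) (L : List ℕ) (a : ℕ) (J : Finset ℕ) :
    rowProductCoeff q x (L ++ [a]) J = ∑ j ∈ J,
      (-q) ^ (J.filter (j < ·)).card • (rowProductCoeff q x L (J.erase j) * x a j) := by
  induction L generalizing J with
  | nil =>
    simp only [List.nil_append, rowProductCoeff]
    refine Finset.sum_congr rfl fun j hj => ?_
    split_ifs with h
    · have hJ : J = {j} := by
        rw [← Finset.insert_erase hj, h]
        rfl
      subst hJ
      simp [Finset.filter_singleton]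
    · simp
  | cons b L ih =>
    simp only [List.cons_append, rowProductCoeff_cons, ih, Finset.mul_sum, Finset.smul_sum,
      Finset.sum_mul]
    rw [sum_sum_erase_eq_sum_sum_lt, sum_sum_erase_eq_sum_sum_lt]
    refine Finset.sum_congr rfl fun j hj => Finset.sum_congr rfl fun k hk => ?_
    obtain ⟨hk, hjk⟩ := Finset.mem_filter.1 hk
    rw [add_comm, filter_lt_erase_of_le hjk.le, filter_gt_erase_of_le hjk.le,
      ← card_filter_gt_erase hk hjk, ← card_filter_lt_erase hj hjk,
      Finset.erase_right_comm (a := k)]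
    simp only [mul_smul_comm, smul_smul, smul_mul_assoc, mul_assoc]
    congr 2 <;> ring

theorem sort_insert_of_forall_lt {I : Finset ℕ} {a : ℕ} (h : ∀ b ∈ I, a < b) :
    (insert a I).sort (· ≤ ·) = a :: I.sort (· ≤ ·) :=
  Finset.sort_insert _ (fun b hb => (h b hb).le) fun ha => lt_irrefl _ (h a ha)

theorem orderedInsert_sort {I : Finset ℕ} {a : ℕ} (h : a ∉ I) :
    (I.sort (· ≤ ·)).orderedInsert (· ≤ ·) a = (insert a I).sort (· ≤ ·) := by
  refine List.Perm.eq_of_pairwise' ((I.pairwise_sort (· ≤ ·)).orderedInsert a _)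
    (Finset.pairwise_sort _ _) ?_
  refine (List.perm_orderedInsert _ _ _).trans ?_
  rw [← Multiset.coe_eq_coe, ← Multiset.cons_coe, Finset.sort_eq, Finset.sort_eq,
    Finset.insert_val_of_notMem h]

theorem length_filter_sort (I : Finset ℕ) (p : ℕ → Prop) [DecidablePred p] :
    ((I.sort (· ≤ ·)).filter p).length = (I.filter p).card := by
  rw [← Multiset.coe_card, ← Multiset.filter_coe, Finset.sort_eq]
  rfl

/-- Row and column expansions agree. -/
theorem rowProductCoeff_sort_transpose (hx : IsQMatrix q m n x) (I J : Finset ℕ)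
    (hI : I ⊆ Finset.Icc 1 m) (hJ : J ⊆ Finset.Icc 1 n) (hIJ : I.card = J.card) :
    rowProductCoeff q x (I.sort (· ≤ ·)) J =
      rowProductCoeff q (fun i j => x j i) (J.sort (· ≤ ·)) I := by
  induction hN : I.card using Nat.strong_induction_on generalizing I J with
  | _ N ih =>
    induction I using Finset.induction_on_min with
    | empty =>
      obtain rfl : J = ∅ := by simpa using hIJ.symm
      simp [rowProductCoeff]
    | insert a I ha ih' =>
    clear ih'
    have haI : a ∉ I := fun h => lt_irrefl _ (ha a h)
    induction J using Finset.induction_on_min with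
    | empty => simp [haI] at hIJ
    | insert c J hc ih' =>
      clear ih'
      have hcJ : c ∉ J := fun h => lt_irrefl _ (hc c h)
      rw [Finset.card_insert_of_notMem haI, Finset.card_insert_of_notMem hcJ,
        add_left_inj] at hIJ
      rw [Finset.card_insert_of_notMem haI] at hN
      have hN' : I.card < N := by omega
      have hI' := (Finset.subset_insert a I).trans hI
      have hJ' := (Finset.subset_insert c J).trans hJ
      have hfilter : ∀ {I : Finset ℕ} {a : ℕ}, (∀ b ∈ I, a < b) →
          (insert a I).filter (· < a) = ∅ := by
        intro I a h
        ext b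
        simp only [Finset.mem_filter, Finset.mem_insert]
        grind
      have hfilter' : ∀ {I : Finset ℕ} {a b : ℕ}, (∀ b ∈ I, a < b) → b ∈ I →
          ((insert a I).filter (· < b)).card = (I.filter (· < b)).card + 1 := by
        intro I a b h hb
        rw [Finset.filter_insert, if_pos (h b hb), Finset.card_insert_of_notMem]
        simpa using fun h' => absurd (h a h') (lt_irrefl _)
      have herase : ∀ {I : Finset ℕ} {a b : ℕ}, (∀ b ∈ I, a < b) → b ∈ I →
          (insert a I).erase b = insert a (I.erase b) :=
        fun h hb => Finset.erase_insert_of_ne (h _ hb).ne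
      have hlt : ∀ {I : Finset ℕ} {a b : ℕ}, (∀ b ∈ I, a < b) → ∀ c ∈ I.erase b, a < c :=
        fun h c hc => h c (Finset.mem_of_mem_erase hc)
      rw [sort_insert_of_forall_lt ha, sort_insert_of_forall_lt hc, rowProductCoeff_cons,
        rowProductCoeff_cons, Finset.sum_insert hcJ, Finset.sum_insert haI, hfilter hc, hfilter ha,
        Finset.erase_insert hcJ, Finset.erase_insert haI, ih _ hN' I J hI' hJ' hIJ rfl]
      congr 1
      have hleft : ∀ j ∈ J, rowProductCoeff q x (I.sort (· ≤ ·)) ((insert c J).erase j) =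
          ∑ r ∈ I, (-q) ^ (I.filter (· < r)).card • (x r c *
            rowProductCoeff q (fun i j => x j i) ((J.erase j).sort (· ≤ ·)) (I.erase r)) := by
        intro j hj
        rw [ih _ hN' _ _ hI' ((Finset.erase_subset _ _).trans hJ) _ rfl, herase hc hj,
          sort_insert_of_forall_lt (hlt hc), rowProductCoeff_cons]
        rw [herase hc hj, Finset.card_insert_of_notMem (by simp [hcJ]),
          Finset.card_erase_add_one hj, hIJ]
      have hright : ∀ r ∈ I, rowProductCoeff q (fun i j => x j i) (J.sort (· ≤ ·))
          ((insert a I).erase r) = ∑ j ∈ J, (-q) ^ (J.filter (· < j)).card • (x a j *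
            rowProductCoeff q (fun i j => x j i) ((J.erase j).sort (· ≤ ·)) (I.erase r)) := by
        intro r hr
        have hcard : ((insert a I).erase r).card = J.card := by
          rw [herase ha hr, Finset.card_insert_of_notMem (by simp [haI]),
            Finset.card_erase_add_one hr, hIJ]
        rw [← ih _ (by omega) _ _ ((Finset.erase_subset _ _).trans hI) hJ' hcard rfl,
          herase ha hr, sort_insert_of_forall_lt (hlt ha), rowProductCoeff_cons]
        refine Finset.sum_congr rfl fun j hj => ?_
        rw [ih _ ((Finset.card_erase_le).trans_lt hN') _ _
          ((Finset.erase_subset _ _).trans hI') ((Finset.erase_subset _ _).trans hJ') _ rfl]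
        rw [Finset.card_erase_of_mem hr, Finset.card_erase_of_mem hj, hIJ]
      trans ∑ j ∈ J, ∑ r ∈ I, (-q) ^ ((J.filter (· < j)).card + 1 + (I.filter (· < r)).card) •
          (x a j * x r c *
            rowProductCoeff q (fun i j => x j i) ((J.erase j).sort (· ≤ ·)) (I.erase r))
      · refine Finset.sum_congr rfl fun j hj => ?_
        rw [hleft j hj, hfilter' hc hj, Finset.mul_sum, Finset.smul_sum]
        refine Finset.sum_congr rfl fun r hr => ?_
        rw [mul_smul_comm, smul_smul, mul_assoc, ← pow_add]
      · rw [Finset.sum_comm]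
        refine Finset.sum_congr rfl fun r hr => ?_
        rw [hright r hr, hfilter' ha hr, Finset.mul_sum, Finset.smul_sum]
        refine Finset.sum_congr rfl fun j hj => ?_
        rw [mul_smul_comm, smul_smul, ← mul_assoc, ← pow_add,
          hx.2.2.1 a r c j (Finset.mem_Icc.1 (hI (by simp))).1 (ha r hr)
            (Finset.mem_Icc.1 (hI' hr)).2 (Finset.mem_Icc.1 (hJ (by simp))).1 (hc j hj)
            (Finset.mem_Icc.1 (hJ' hj)).2]
        congr 2
        ring

/-- The permutation of `Fin (k + 1)` sending `0` to `p` and acting as `τ` on the rest. -/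
def Equiv.Perm.consSuccAbove {k : ℕ} (p : Fin (k + 1)) (τ : Equiv.Perm (Fin k)) :
    Equiv.Perm (Fin (k + 1)) :=
  (Equiv.Perm.decomposeFin.symm (0, τ)).trans p.cycleRange.symm

theorem Equiv.Perm.consSuccAbove_zero {k : ℕ} (p : Fin (k + 1)) (τ : Equiv.Perm (Fin k)) :
    consSuccAbove p τ 0 = p := by
  simp [consSuccAbove]

theorem Equiv.Perm.consSuccAbove_succ {k : ℕ} (p : Fin (k + 1)) (τ : Equiv.Perm (Fin k))
    (d : Fin k) : consSuccAbove p τ d.succ = p.succAbove (τ d) := by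
  simp [consSuccAbove]

theorem Equiv.Perm.consSuccAbove_bijective (k : ℕ) : Function.Bijective
    fun pτ : Fin (k + 1) × Equiv.Perm (Fin k) => consSuccAbove pτ.1 pτ.2 := by
  rw [Fintype.bijective_iff_injective_and_card]
  constructor
  · rintro ⟨p, τ⟩ ⟨p', τ'⟩ h
    have h0 := DFunLike.congr_fun h 0
    simp only [consSuccAbove_zero] at h0
    subst h0
    congr
    ext d : 1
    have hd := DFunLike.congr_fun h d.succ
    simpa only [consSuccAbove_succ, Fin.succAbove_right_inj] using hd
  · simp [Fintype.card_perm, Nat.factorial_succ]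

theorem card_filter_succAbove_lt {k : ℕ} (p : Fin (k + 1)) :
    (Finset.univ.filter fun d : Fin k => p.succAbove d < p).card = p := by
  have h : (Finset.univ.filter fun d : Fin k => p.succAbove d < p).map p.succAboveEmb =
      Finset.Iio p := by
    ext c
    simp only [Finset.mem_map, Finset.mem_filter, Finset.mem_univ, true_and, Finset.mem_Iio,
      Fin.coe_succAboveEmb]
    constructor
    · rintro ⟨d, hd, rfl⟩
      exact hd
    · intro hc
      obtain ⟨d, rfl⟩ := Fin.exists_succAbove_eq hc.ne
      exact ⟨d, hc, rfl⟩
  rw [← Finset.card_map p.succAboveEmb, h, Fin.card_Iio]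

theorem permInversions_consSuccAbove {k : ℕ} (p : Fin (k + 1)) (τ : Equiv.Perm (Fin k)) :
    permInversions (Equiv.Perm.consSuccAbove p τ) = p + permInversions τ := by
  have h := card_filter_succAbove_lt p
  simp only [permInversions, Finset.card_filter, Fintype.sum_prod_type, Fin.sum_univ_succ,
    Equiv.Perm.consSuccAbove_zero, Equiv.Perm.consSuccAbove_succ, Fin.succ_lt_succ_iff,
    Fin.succAbove_lt_succAbove_iff, Fin.succ_pos, Fin.not_lt_zero, true_and,
    false_and, if_false, zero_add] at h ⊢
  rw [Equiv.sum_comp τ fun d => if p.succAbove d < p then 1 else 0, h]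

theorem card_filter_lt_orderEmbOfFin {k : ℕ} (J : Finset ℕ) (hJ : J.card = k) (p : Fin k) :
    (J.filter (· < J.orderEmbOfFin hJ p)).card = p := by
  have h : (Finset.Iio p).map (J.orderEmbOfFin hJ).toEmbedding =
      J.filter (· < J.orderEmbOfFin hJ p) := by
    conv_rhs => enter [2]; rw [← Finset.map_orderEmbOfFin_univ J hJ]
    ext c
    simp only [Finset.mem_map, Finset.mem_filter, Finset.mem_univ, true_and, Finset.mem_Iio,
      RelEmbedding.coe_toEmbedding]
    constructor
    · rintro ⟨d, hd, rfl⟩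
      exact ⟨⟨d, rfl⟩, (J.orderEmbOfFin hJ).lt_iff_lt.2 hd⟩
    · rintro ⟨⟨d, rfl⟩, hd⟩
      exact ⟨d, (J.orderEmbOfFin hJ).lt_iff_lt.1 hd, rfl⟩
  rw [← h, Finset.card_map, Fin.card_Iio]

theorem orderEmbOfFin_succAbove {k : ℕ} (J : Finset ℕ) (hJ : J.card = k + 1) (p : Fin (k + 1))
    (h : (J.erase (J.orderEmbOfFin hJ p)).card = k) (d : Fin k) :
    J.orderEmbOfFin hJ (p.succAbove d) = (J.erase (J.orderEmbOfFin hJ p)).orderEmbOfFin h d := by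
  refine congr_fun (Finset.orderEmbOfFin_unique h
    (f := fun d => J.orderEmbOfFin hJ (p.succAbove d)) (fun d => ?_) ?_) d
  · simp [Fin.succAbove_ne]
  · exact (J.orderEmbOfFin hJ).strictMono.comp (Fin.strictMono_succAbove p)

theorem sum_perm_eq_rowProductCoeff (q : K) (x : ℕ → ℕ → A) {k : ℕ} (f : Fin k → ℕ)
    (J : Finset ℕ) (hJ : J.card = k) :
    ∑ σ : Equiv.Perm (Fin k), (-q) ^ permInversions σ •
        (List.ofFn fun d => x (f d) (J.orderEmbOfFin hJ (σ d))).prod =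
      rowProductCoeff q x (List.ofFn f) J := by
  induction k generalizing J with
  | zero =>
    obtain rfl := Finset.card_eq_zero.1 hJ
    simp [rowProductCoeff, permInversions]
  | succ k ih =>
    have hcard : ∀ p, (J.erase (J.orderEmbOfFin hJ p)).card = k := fun p => by
      rw [Finset.card_erase_of_mem (J.orderEmbOfFin_mem hJ p), hJ, Nat.add_sub_cancel]
    rw [← (Equiv.Perm.consSuccAbove_bijective k).sum_comp, Fintype.sum_prod_type, List.ofFn_succ,
      rowProductCoeff_cons]
    conv_rhs => enter [1]; rw [← Finset.map_orderEmbOfFin_univ J hJ]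
    rw [Finset.sum_map]
    refine Finset.sum_congr rfl fun p _ => ?_
    rw [RelEmbedding.coe_toEmbedding, card_filter_lt_orderEmbOfFin, ← ih _ _ (hcard p),
      Finset.mul_sum, Finset.smul_sum]
    refine Finset.sum_congr rfl fun τ _ => ?_
    simp only [List.ofFn_succ, List.prod_cons, permInversions_consSuccAbove,
      Equiv.Perm.consSuccAbove_zero, Equiv.Perm.consSuccAbove_succ,
      orderEmbOfFin_succAbove J hJ p (hcard p), mul_smul_comm, smul_smul, pow_add]

theorem qMinor_eq_rowProductCoeff (q : K) (x : ℕ → ℕ → A) {I J : Finset ℕ}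
    (h : I.card = J.card) : qMinor q x I J = rowProductCoeff q x (I.sort (· ≤ ·)) J := by
  rw [qMinor, dif_pos h, sum_perm_eq_rowProductCoeff]
  congr 1
  refine List.ext_getElem (by simp) fun i h1 h2 => ?_
  simp [Finset.orderEmbOfFin_apply]

theorem sort_pairwise_lt (I : Finset ℕ) : (I.sort (· ≤ ·)).Pairwise (· < ·) :=
  I.sortedLT_sort.pairwise

/-- Expansion of a quantum minor along its last column, for an arbitrary last row `a`. -/
theorem sum_qMinor_erase_mul (hq : q ≠ 0) (hx : IsQMatrix q m n x) {I J : Finset ℕ} {a : ℕ}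
    (hI : I ⊆ Finset.Icc 1 m) (hJ : J ⊆ Finset.Icc 1 n) (ha : a ∈ Finset.Icc 1 m)
    (hIJ : I.card + 1 = J.card) :
    ∑ j ∈ J, (-q) ^ (J.filter (j < ·)).card • (qMinor q x I (J.erase j) * x a j) =
      if a ∈ I then 0 else (-q) ^ (I.filter (a < ·)).card • qMinor q x (insert a I) J := by
  have h := rowProductCoeff_append_of_sorted hq hx (Finset.mem_Icc.1 ha).1 (Finset.mem_Icc.1 ha).2
    (I.sort (· ≤ ·)) (sort_pairwise_lt I)
    (fun b hb => Finset.mem_Icc.1 (hI ((Finset.mem_sort _).1 hb))) J hJ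
  simp only [Finset.mem_sort, length_filter_sort] at h
  rw [rowProductCoeff_append] at h
  rw [Finset.sum_congr rfl fun j hj => by rw [qMinor_eq_rowProductCoeff q x
    (by rw [Finset.card_erase_of_mem hj, ← hIJ, Nat.add_sub_cancel])], h]
  split_ifs with haI
  · rw [zero_smul]
  · rw [orderedInsert_sort haI, qMinor_eq_rowProductCoeff q x
      (by rw [Finset.card_insert_of_notMem haI, hIJ])]

theorem qMinor_transpose (hx : IsQMatrix q m n x) {I J : Finset ℕ} (hI : I ⊆ Finset.Icc 1 m)
    (hJ : J ⊆ Finset.Icc 1 n) (hIJ : I.card = J.card) :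
    qMinor q x I J = qMinor q (fun i j => x j i) J I := by
  rw [qMinor_eq_rowProductCoeff q x hIJ, qMinor_eq_rowProductCoeff q _ hIJ.symm,
    rowProductCoeff_sort_transpose hx I J hI hJ hIJ]

/-- Expansion of a quantum minor along its first column, for an arbitrary first column `b`. -/
theorem sum_mul_qMinor_erase (hq : q ≠ 0) (hx : IsQMatrix q m n x) {I J : Finset ℕ} {b : ℕ}
    (hI : I ⊆ Finset.Icc 1 m) (hJ : J ⊆ Finset.Icc 1 n) (hb : b ∈ Finset.Icc 1 n)
    (hIJ : I.card = J.card + 1) :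
    ∑ r ∈ I, (-q) ^ (I.filter (· < r)).card • (x r b * qMinor q x (I.erase r) J) =
      if b ∈ J then 0 else (-q) ^ (J.filter (· < b)).card • qMinor q x I (insert b J) := by
  have h := rowProductCoeff_cons_of_sorted hq hx.transpose (Finset.mem_Icc.1 hb).1
    (Finset.mem_Icc.1 hb).2 (J.sort (· ≤ ·)) (sort_pairwise_lt J)
    (fun b hb => Finset.mem_Icc.1 (hJ ((Finset.mem_sort _).1 hb))) I hI
  simp only [Finset.mem_sort, length_filter_sort] at h
  rw [rowProductCoeff_cons] at h
  have hcard : ∀ r ∈ I, (I.erase r).card = J.card := fun r hr => by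
    rw [Finset.card_erase_of_mem hr, hIJ, Nat.add_sub_cancel]
  rw [Finset.sum_congr rfl fun r hr => by
    rw [qMinor_transpose hx ((Finset.erase_subset _ _).trans hI) hJ (hcard r hr),
      qMinor_eq_rowProductCoeff q _ (hcard r hr).symm], h]
  split_ifs with hbJ
  · rw [zero_smul]
  · have hcard' : I.card = (insert b J).card := by rw [Finset.card_insert_of_notMem hbJ, hIJ]
    rw [orderedInsert_sort hbJ, qMinor_transpose hx hI (Finset.insert_subset hb hJ) hcard',
      qMinor_eq_rowProductCoeff q _ hcard'.symm]

end LaplaceExpansion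

/-- Dodgson-type identity for quantum minors. -/
theorem qMinor_dodgson
    {K A : Type} [Field K] [Ring A] [Algebra K A] {m n : ℕ}
    (q : K) (hq : q ≠ 0) (x : ℕ → ℕ → A) (hx : IsQMatrix q m n x)
    (i k : ℕ) (h1i : 1 ≤ i) (hik : i < k) (hkm : k ≤ m)
    (X : Finset ℕ) (hXm : X ⊆ Finset.Icc 1 m) (hiX : i ∉ X) (hkX : k ∉ X)
    (i' k' : ℕ) (h1i' : 1 ≤ i') (hik' : i' < k') (hk'n : k' ≤ n)
    (X' : Finset ℕ) (hX'n : X' ⊆ Finset.Icc 1 n) (hi'X' : i' ∉ X') (hk'X' : k' ∉ X')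
    (hcard : X'.card = X.card) :
    qMinor q x (insert i X) (insert i' X') * qMinor q x (insert k X) (insert k' X') =
      q • (qMinor q x (insert i X) (insert k' X') * qMinor q x (insert k X) (insert i' X')) +
        qMinor q x (insert i (insert k X)) (insert i' (insert k' X')) * qMinor q x X X' := by
  have hlt_gt : ∀ {S : Finset ℕ} {a : ℕ}, a ∉ S →
      (S.filter (· < a)).card + (S.filter (a < ·)).card = S.card := by
    intro S a ha
    rw [← Finset.card_filter_add_card_filter_not (s := S) (· < a)]
    congr 2
    refine Finset.filter_congr fun b hb => ?_
    have : b ≠ a := fun h => ha (h ▸ hb)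
    omega
  have hi : i ∈ Finset.Icc 1 m := Finset.mem_Icc.2 ⟨h1i, hik.le.trans hkm⟩
  have hk : k ∈ Finset.Icc 1 m := Finset.mem_Icc.2 ⟨h1i.trans hik.le, hkm⟩
  have hi' : i' ∈ Finset.Icc 1 n := Finset.mem_Icc.2 ⟨h1i', hik'.le.trans hk'n⟩
  have hk' : k' ∈ Finset.Icc 1 n := Finset.mem_Icc.2 ⟨h1i'.trans hik'.le, hk'n⟩
  have hiX_card := Finset.card_insert_of_notMem hiX
  have hkX_card := Finset.card_insert_of_notMem hkX
  have hk'X'_card := Finset.card_insert_of_notMem hk'X'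
  have hi'kX' : i' ∉ insert k' X' := by simp [hik'.ne, hi'X']
  have hC_card := Finset.card_insert_of_notMem hi'kX'
  have hkiX : k ∉ insert i X := by simp [hik.ne', hkX]
  set C := insert i' (insert k' X') with hC
  have hCn : C ⊆ Finset.Icc 1 n := Finset.insert_subset hi' (Finset.insert_subset hk' hX'n)
  have hiXm := Finset.insert_subset hi hXm
  have hkXm := Finset.insert_subset hk hXm
  -- Evaluate a double expansion in both orders of summation.
  have hrows : ∑ r ∈ insert k X, ∑ j ∈ C,
      (-q) ^ ((C.filter (j < ·)).card + ((insert k X).filter (· < r)).card) •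
        (qMinor q x (insert i X) (C.erase j) * x r j * qMinor q x ((insert k X).erase r) X') =
      (-q) ^ X.card • (qMinor q x (insert i (insert k X)) C * qMinor q x X X') := by
    have h : ∀ r ∈ insert k X, ∑ j ∈ C,
        (-q) ^ ((C.filter (j < ·)).card + ((insert k X).filter (· < r)).card) •
          (qMinor q x (insert i X) (C.erase j) * x r j * qMinor q x ((insert k X).erase r) X') =
        (-q) ^ ((insert k X).filter (· < r)).card •
          ((if r ∈ insert i X then 0 else (-q) ^ ((insert i X).filter (r < ·)).card •
            qMinor q x (insert r (insert i X)) C) * qMinor q x ((insert k X).erase r) X') := by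
      intro r hr
      rw [← sum_qMinor_erase_mul hq hx hiXm hCn (hkXm hr) (by omega), Finset.sum_mul,
        Finset.smul_sum]
      refine Finset.sum_congr rfl fun j _ => ?_
      rw [smul_mul_assoc, smul_smul, ← pow_add, add_comm]
    rw [Finset.sum_congr rfl h, Finset.sum_insert hkX, Finset.sum_eq_zero, add_zero, if_neg hkiX,
      Finset.erase_insert hkX, Finset.insert_comm k i, smul_mul_assoc, smul_smul, ← pow_add,
      Finset.filter_insert, if_neg (lt_irrefl k), Finset.filter_insert, if_neg hik.not_gt,
      hlt_gt hkX]
    intro r hr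
    rw [if_pos (Finset.mem_insert_of_mem hr), zero_mul, smul_zero]
  have hcols : ∑ j ∈ C, ∑ r ∈ insert k X,
      (-q) ^ ((C.filter (j < ·)).card + ((insert k X).filter (· < r)).card) •
        (qMinor q x (insert i X) (C.erase j) * x r j * qMinor q x ((insert k X).erase r) X') =
      (-q) ^ X.card • ((-q) • (qMinor q x (insert i X) (insert k' X') *
          qMinor q x (insert k X) (insert i' X')) +
        qMinor q x (insert i X) (insert i' X') * qMinor q x (insert k X) (insert k' X')) := by
    have h : ∀ j ∈ C, ∑ r ∈ insert k X,
        (-q) ^ ((C.filter (j < ·)).card + ((insert k X).filter (· < r)).card) •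
          (qMinor q x (insert i X) (C.erase j) * x r j * qMinor q x ((insert k X).erase r) X') =
        (-q) ^ (C.filter (j < ·)).card • (qMinor q x (insert i X) (C.erase j) *
          if j ∈ X' then 0 else (-q) ^ (X'.filter (· < j)).card •
            qMinor q x (insert k X) (insert j X')) := by
      intro j hj
      rw [← sum_mul_qMinor_erase hq hx hkXm hX'n (hCn hj) (by omega), Finset.mul_sum,
        Finset.smul_sum]
      refine Finset.sum_congr rfl fun r _ => ?_
      rw [mul_smul_comm, smul_smul, ← pow_add, mul_assoc]
    have he : C.erase k' = insert i' X' := by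
      rw [hC, Finset.erase_insert_of_ne hik'.ne, Finset.erase_insert hk'X']
    have hfi : (C.filter (i' < ·)).card = (X'.filter (i' < ·)).card + 1 := by
      rw [hC, Finset.filter_insert, if_neg (lt_irrefl i'), Finset.filter_insert, if_pos hik',
        Finset.card_insert_of_notMem (by simp [hk'X'])]
    have hfk : C.filter (k' < ·) = X'.filter (k' < ·) := by
      rw [hC, Finset.filter_insert, if_neg hik'.not_gt, Finset.filter_insert,
        if_neg (lt_irrefl k')]
    have hci := hlt_gt hi'X'
    have hck := hlt_gt hk'X'
    rw [Finset.sum_congr rfl h, hC, Finset.sum_insert hi'kX', Finset.sum_insert hk'X', ← hC,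
      Finset.sum_eq_zero, add_zero, if_neg hi'X', if_neg hk'X', he, hfi, hfk, hC,
      Finset.erase_insert hi'kX', mul_smul_comm, mul_smul_comm, smul_smul, smul_smul, ← pow_add,
      ← pow_add, smul_add, smul_smul, ← pow_succ]
    · congr 3 <;> omega
    · intro j hj
      rw [if_pos hj, mul_zero, smul_zero]
  rw [Finset.sum_comm, hcols] at hrows
  rw [← smul_right_injective A (pow_ne_zero X.card (neg_ne_zero.2 hq)) hrows, neg_smul]
  abel
end

section
/- Let K be a field, q a nonzero element of K, and x an m×n q-matrix with entries in an associative unital K-algebra A. Let I, J ⊆ {1,…,n} with |I| − |J| ≥ 2 and |I| − 1 ≤ m. Then Σ_{a ∈ I−J} (−q)^{Inv(a, I−{a}) − Inv(a, J)} [J∪{a}]·[I−{a}] = 0, where the minors are flag quantum minors. -/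
/-- `X < Y` elementwise: every element of `X` is smaller than every element of `Y`. -/
def finsetLT (X Y : Finset ℕ) : Prop := ∀ a ∈ X, ∀ b ∈ Y, a < b

/-- One-sided weak separation: `|I| ≥ |J|` and `J - I` has a partition `J₁ ∪ J₂`
with `J₁ < I - J < J₂`. -/
def WShalf (I J : Finset ℕ) : Prop :=
  J.card ≤ I.card ∧ ∃ J₁ J₂ : Finset ℕ, Disjoint J₁ J₂ ∧ J₁ ∪ J₂ = J \ I ∧
    finsetLT J₁ (I \ J) ∧ finsetLT (I \ J) J₂

/-- `I` and `J` are weakly separated. -/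
def WeaklySeparated (I J : Finset ℕ) : Prop := WShalf I J ∨ WShalf J I

/-- `Inv(A,B)`: the number of pairs `(a,b) ∈ A × B` with `a > b`. -/
def invPairs (A B : Finset ℕ) : ℕ := ((A ×ˢ B).filter (fun p => p.2 < p.1)).card

section QuantumMinors

open Finset

/-- The number of elements of `S` below `j`. -/
def countBelow (S : Finset ℕ) (j : ℕ) : ℕ := (S.filter (· < j)).card

/-- The number of elements of `S` above `i`. -/
def countAbove (S : Finset ℕ) (i : ℕ) : ℕ := (S.filter (i < ·)).card

lemma countBelow_erase_of_le {S : Finset ℕ} {j k : ℕ} (h : j ≤ k) :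
    countBelow (S.erase k) j = countBelow S j := by
  unfold countBelow
  congr 1
  ext b
  simp only [mem_filter, mem_erase]
  grind

lemma countBelow_erase_add_one {S : Finset ℕ} {j k : ℕ} (hj : j ∈ S) (h : j < k) :
    countBelow (S.erase j) k + 1 = countBelow S k := by
  unfold countBelow
  rw [filter_erase]
  exact card_erase_add_one (by simp [hj, h])

lemma countAbove_erase_of_le {S : Finset ℕ} {j k : ℕ} (h : j ≤ k) :
    countAbove (S.erase j) k = countAbove S k := by
  unfold countAbove
  congr 1
  ext b
  simp only [mem_filter, mem_erase]
  grind

lemma countAbove_erase_add_one {S : Finset ℕ} {j k : ℕ} (hk : k ∈ S) (h : j < k) :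
    countAbove (S.erase k) j + 1 = countAbove S j := by
  unfold countAbove
  rw [filter_erase]
  exact card_erase_add_one (by simp [hk, h])

lemma countBelow_insert_of_le {S : Finset ℕ} {j k : ℕ} (h : j ≤ k) :
    countBelow (insert k S) j = countBelow S j := by
  unfold countBelow
  congr 1
  ext b
  simp only [mem_filter, mem_insert]
  grind

lemma countAbove_insert_of_le {S : Finset ℕ} {j k : ℕ} (h : j ≤ k) :
    countAbove (insert j S) k = countAbove S k := by
  unfold countAbove
  congr 1
  ext b
  simp only [mem_filter, mem_insert]
  grind

lemma countAbove_insert_of_lt {S : Finset ℕ} {j k : ℕ} (hk : k ∉ S) (h : j < k) :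
    countAbove (insert k S) j = countAbove S j + 1 := by
  rw [← countAbove_erase_add_one (mem_insert_self k S) h, erase_insert hk]

lemma countBelow_eq_card {S : Finset ℕ} {k : ℕ} (h : ∀ j ∈ S, j < k) :
    countBelow S k = S.card := by
  rw [countBelow, filter_true_of_mem h]

lemma countAbove_eq_card {S : Finset ℕ} {k : ℕ} (h : ∀ j ∈ S, k < j) :
    countAbove S k = S.card := by
  rw [countAbove, filter_true_of_mem h]

lemma countAbove_eq_zero {S : Finset ℕ} {k : ℕ} (h : ∀ j ∈ S, j ≤ k) :
    countAbove S k = 0 := by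
  rw [countAbove, card_eq_zero, filter_eq_empty_iff]
  exact fun j hj => not_lt.2 (h j hj)

lemma countBelow_add_countAbove {S : Finset ℕ} {a : ℕ} (ha : a ∉ S) :
    countBelow S a + countAbove S a = S.card := by
  rw [← card_filter_add_card_filter_not (s := S) (· < a), countBelow, countAbove]
  congr 2
  ext b
  simp only [mem_filter]
  grind

lemma invPairs_singleton (a : ℕ) (S : Finset ℕ) : invPairs {a} S = countBelow S a := by
  unfold invPairs countBelow
  refine card_bij' (fun p _ => p.2) (fun b _ => (a, b)) ?_ ?_ ?_ ?_ <;> grind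

lemma sum_sum_erase_s12 {M : Type*} [AddCommMonoid M] (S : Finset ℕ) (F : ℕ → ℕ → M) :
    ∑ j ∈ S, ∑ k ∈ S.erase j, F j k = ∑ j ∈ S, ∑ k ∈ S with j < k, (F j k + F k j) := by
  have h1 : ∀ j, ∑ k ∈ S.erase j, F j k
      = ∑ k ∈ S with j < k, F j k + ∑ k ∈ S with k < j, F j k := by
    intro j
    rw [← sum_union]
    · refine sum_congr ?_ fun _ _ => rfl
      ext k
      simp only [mem_erase, mem_union, mem_filter]
      grind
    · rw [disjoint_filter]
      grind
  simp_rw [h1, sum_add_distrib]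
  congr 1
  simp_rw [sum_filter]
  rw [sum_comm]

variable {K A : Type} [Field K] [Ring A] [Algebra K A]

/-- Left multiplication by `∑ⱼ yⱼ eⱼ` on the quantum exterior algebra with coefficients in `A`,
an element `∑ ω(S) e_S` being represented by its coefficient function `ω`. -/
def leftWedge (q : K) (y : ℕ → A) (ω : Finset ℕ → A) (S : Finset ℕ) : A :=
  ∑ j ∈ S, (-q) ^ countBelow S j • (y j * ω (S.erase j))

/-- Right multiplication by `∑ᵢ yᵢ eᵢ` on the quantum exterior algebra. -/
def rightWedge (q : K) (y : ℕ → A) (ω : Finset ℕ → A) (S : Finset ℕ) : A :=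
  ∑ i ∈ S, (-q) ^ countAbove S i • (ω (S.erase i) * y i)

lemma leftWedge_leftWedge (q : K) (y z : ℕ → A) (ω : Finset ℕ → A) (S : Finset ℕ) :
    leftWedge q y (leftWedge q z ω) S = ∑ j ∈ S, ∑ k ∈ S with j < k,
      (-q) ^ (countBelow S j + countBelow (S.erase j) k) •
        ((y j * z k - q • (y k * z j)) * ω ((S.erase j).erase k)) := by
  simp only [leftWedge, mul_sum, smul_sum]
  rw [sum_sum_erase_s12]
  refine sum_congr rfl fun j hj => sum_congr rfl fun k hk => ?_
  rw [mem_filter] at hk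
  rw [countBelow_erase_of_le hk.2.le, ← countBelow_erase_add_one hj hk.2,
    erase_right_comm (a := k) (b := j)]
  simp only [mul_smul_comm, smul_smul, sub_mul, smul_mul_assoc, smul_sub, mul_assoc]
  rw [sub_eq_add_neg, ← neg_smul]
  congr 2 <;> ring

lemma rightWedge_rightWedge (q : K) (y z : ℕ → A) (ω : Finset ℕ → A) (S : Finset ℕ) :
    rightWedge q y (rightWedge q z ω) S = ∑ j ∈ S, ∑ k ∈ S with j < k,
      (-q) ^ (countAbove S k + countAbove (S.erase k) j) •
        (ω ((S.erase j).erase k) * (z j * y k - q • (z k * y j))) := by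
  simp only [rightWedge, sum_mul, smul_sum]
  rw [sum_sum_erase_s12]
  refine sum_congr rfl fun j hj => sum_congr rfl fun k hk => ?_
  rw [mem_filter] at hk
  rw [countAbove_erase_of_le hk.2.le, ← countAbove_erase_add_one hk.1 hk.2,
    erase_right_comm (a := k) (b := j)]
  simp only [mul_smul_comm, smul_smul, mul_sub, smul_mul_assoc, smul_sub, mul_assoc]
  rw [add_comm, sub_eq_add_neg, ← neg_smul]
  congr 2 <;> ring

lemma leftWedge_self_eq_zero {q : K} {y : ℕ → A} {S : Finset ℕ}
    (h : ∀ j ∈ S, ∀ k ∈ S, j < k → y j * y k = q • (y k * y j)) (ω : Finset ℕ → A) :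
    leftWedge q y (leftWedge q y ω) S = 0 := by
  rw [leftWedge_leftWedge]
  refine sum_eq_zero fun j hj => sum_eq_zero fun k hk => ?_
  rw [mem_filter] at hk
  rw [h j hj k hk.1 hk.2, sub_self, zero_mul, smul_zero]

lemma rightWedge_self_eq_zero {q : K} {y : ℕ → A} {S : Finset ℕ}
    (h : ∀ j ∈ S, ∀ k ∈ S, j < k → y j * y k = q • (y k * y j)) (ω : Finset ℕ → A) :
    rightWedge q y (rightWedge q y ω) S = 0 := by
  rw [rightWedge_rightWedge]
  refine sum_eq_zero fun j hj => sum_eq_zero fun k hk => ?_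
  rw [mem_filter] at hk
  rw [h j hj k hk.1 hk.2, sub_self, mul_zero, smul_zero]

lemma leftWedge_swap {q : K} {y z : ℕ → A} {S : Finset ℕ}
    (h : ∀ j ∈ S, ∀ k ∈ S, j < k →
      y j * z k - q • (y k * z j) = -q • (z j * y k - q • (z k * y j))) (ω : Finset ℕ → A) :
    leftWedge q y (leftWedge q z ω) S = -q • leftWedge q z (leftWedge q y ω) S := by
  rw [leftWedge_leftWedge, leftWedge_leftWedge, smul_sum]
  refine sum_congr rfl fun j hj => ?_
  rw [smul_sum]
  refine sum_congr rfl fun k hk => ?_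
  rw [mem_filter] at hk
  rw [h j hj k hk.1 hk.2, smul_mul_assoc, smul_comm]

lemma rightWedge_swap {q : K} {y z : ℕ → A} {S : Finset ℕ}
    (h : ∀ j ∈ S, ∀ k ∈ S, j < k →
      z j * y k - q • (z k * y j) = -q • (y j * z k - q • (y k * z j))) (ω : Finset ℕ → A) :
    rightWedge q y (rightWedge q z ω) S = -q • rightWedge q z (rightWedge q y ω) S := by
  rw [rightWedge_rightWedge, rightWedge_rightWedge, smul_sum]
  refine sum_congr rfl fun j hj => ?_
  rw [smul_sum]
  refine sum_congr rfl fun k hk => ?_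
  rw [mem_filter] at hk
  rw [h j hj k hk.1 hk.2, mul_smul_comm, smul_comm]

/-- The common form of the relation between two rows, or two columns, of a `q`-matrix. -/
lemma manin_swap {q : K} (hq : q ≠ 0) {a b c d : A} (hbc : b * c = c * b)
    (had : a * d - d * a = (q - q⁻¹) • (b * c)) :
    c * b - q • (d * a) = -q • (a * d - q • (b * c)) := by
  have had' : a * d = d * a + (q - q⁻¹) • (b * c) := by rw [← had]; abel
  rw [had', ← hbc]
  simp only [smul_sub, smul_add, smul_smul, neg_smul, sub_smul]
  match_scalars
  · field_simp
    ring
  · field_simp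

/-- The quantum minor with row and column labels given by functions. -/
def qDet (q : K) (x : ℕ → ℕ → A) {k : ℕ} (r c : Fin k → ℕ) : A :=
  ∑ σ : Equiv.Perm (Fin k), (-q) ^ permInversions σ •
    (List.ofFn fun d => x (r d) (c (σ d))).prod

lemma qMinor_eq_qDet (q : K) (x : ℕ → ℕ → A) {I J : Finset ℕ} {k : ℕ}
    (hI : I.card = k) (hJ : J.card = k) :
    qMinor q x I J = qDet q x (I.orderEmbOfFin hI) (J.orderEmbOfFin hJ) := by
  subst hI
  rw [qMinor, dif_pos hJ.symm, qDet]

lemma qMinor_eq_zero (q : K) (x : ℕ → ℕ → A) {I J : Finset ℕ} (h : I.card ≠ J.card) :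
    qMinor q x I J = 0 := by
  rw [qMinor, dif_neg h]

/-- The permutation of `Fin (k + 1)` sending `0` to `p` and acting as `τ` between the complements. -/
def permCons {k : ℕ} (p : Fin (k + 1)) (τ : Equiv.Perm (Fin k)) : Equiv.Perm (Fin (k + 1)) :=
  (finSuccEquiv' 0).trans ((Equiv.optionCongr τ).trans (finSuccEquiv' p).symm)

lemma permCons_zero {k : ℕ} (p : Fin (k + 1)) (τ : Equiv.Perm (Fin k)) :
    permCons p τ 0 = p := by
  simp [permCons]

lemma permCons_succ {k : ℕ} (p : Fin (k + 1)) (τ : Equiv.Perm (Fin k)) (d : Fin k) :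
    permCons p τ d.succ = p.succAbove (τ d) := by
  rw [← Fin.succAbove_zero_apply]
  simp only [permCons, Equiv.trans_apply, finSuccEquiv'_succAbove]
  simp

lemma permCons_bijective (k : ℕ) : Function.Bijective
    fun s : Fin (k + 1) × Equiv.Perm (Fin k) => permCons s.1 s.2 := by
  rw [Fintype.bijective_iff_injective_and_card]
  refine ⟨?_, by simp [Fintype.card_perm, Nat.factorial_succ]⟩
  rintro ⟨p, τ⟩ ⟨p', τ'⟩ h
  have hp : p = p' := by
    simpa only [permCons_zero] using DFunLike.congr_fun h 0
  subst hp
  refine Prod.ext rfl (Equiv.ext fun d => ?_)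
  have hd := DFunLike.congr_fun h d.succ
  simp only [permCons_succ] at hd
  exact Fin.succAbove_right_injective hd

lemma card_succAbove_lt {k : ℕ} (p : Fin (k + 1)) :
    (univ.filter fun d : Fin k => p.succAbove d < p).card = p := by
  have h : ∀ d : Fin k, p.succAbove d < p ↔ (d : ℕ) < p := fun d => by
    rw [Fin.succAbove_lt_iff_castSucc_lt, Fin.lt_def, Fin.val_castSucc]
  simp_rw [h, Fin.card_filter_val_lt]
  omega

lemma permInversions_permCons {k : ℕ} (p : Fin (k + 1)) (τ : Equiv.Perm (Fin k)) :
    permInversions (permCons p τ) = p + permInversions τ := by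
  have hp : (univ.filter fun d : Fin k => p.succAbove (τ d) < p).card = p := by
    conv_rhs => rw [← card_succAbove_lt p]
    exact card_equiv τ (by simp)
  conv_rhs => rw [← hp]
  simp only [permInversions, card_filter, Fintype.sum_prod_type, Fin.sum_univ_succ,
    permCons_zero, permCons_succ]
  simp

lemma qDet_succ (q : K) (x : ℕ → ℕ → A) {k : ℕ} (r c : Fin (k + 1) → ℕ) :
    qDet q x r c = ∑ p : Fin (k + 1), (-q) ^ (p : ℕ) •
      (x (r 0) (c p) * qDet q x (r ∘ Fin.succ) (c ∘ p.succAbove)) := by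
  rw [qDet, ← (permCons_bijective k).sum_comp, Fintype.sum_prod_type]
  refine sum_congr rfl fun p _ => ?_
  rw [qDet, mul_sum, smul_sum]
  refine sum_congr rfl fun τ _ => ?_
  simp only [permInversions_permCons, List.ofFn_succ, List.prod_cons, permCons_zero,
    permCons_succ, mul_smul_comm, smul_smul, pow_add, Function.comp_apply]

lemma countBelow_orderEmbOfFin {J : Finset ℕ} {k : ℕ} (hJ : J.card = k) (p : Fin k) :
    countBelow J (J.orderEmbOfFin hJ p) = p := by
  have h : J.filter (· < J.orderEmbOfFin hJ p)
      = (univ.filter (· < p)).map (J.orderEmbOfFin hJ).toEmbedding := by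
    ext b
    simp only [mem_filter, mem_map, mem_univ, true_and, RelEmbedding.coe_toEmbedding]
    constructor
    · rintro ⟨hb, hlt⟩
      have hb' : b ∈ Set.range (J.orderEmbOfFin hJ) := by simpa using hb
      obtain ⟨d, rfl⟩ := hb'
      exact ⟨d, by simpa using hlt, rfl⟩
    · rintro ⟨d, hd, rfl⟩
      exact ⟨orderEmbOfFin_mem _ _ _, by simpa using hd⟩
  rw [countBelow, h, card_map, filter_gt_eq_Iio, Fin.card_Iio]

/-- Expansion of a quantum minor along its first row. -/
lemma qMinor_insert_row (q : K) (x : ℕ → ℕ → A) {i : ℕ} {I : Finset ℕ} (hi : ∀ l ∈ I, i < l)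
    (J : Finset ℕ) :
    qMinor q x (insert i I) J = leftWedge q (x i) (qMinor q x I) J := by
  have hiI : i ∉ I := fun h => lt_irrefl _ (hi i h)
  have hc : (insert i I).card = I.card + 1 := card_insert_of_notMem hiI
  by_cases hJ : J.card = I.card + 1
  · rw [qMinor_eq_qDet q x hc hJ, qDet_succ, leftWedge]
    have hsum : ∀ f : ℕ → A, ∑ j ∈ J, f j
        = ∑ p : Fin (I.card + 1), f (J.orderEmbOfFin hJ p) := fun f => by
      conv_lhs => rw [← image_orderEmbOfFin_univ J hJ]
      rw [sum_image (fun a _ b _ h => (J.orderEmbOfFin hJ).injective h)]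
    have hr : StrictMono (Fin.cons i (I.orderEmbOfFin rfl) : Fin (I.card + 1) → ℕ) := by
      intro d e hde
      induction d using Fin.cases with
      | zero =>
        induction e using Fin.cases with
        | zero => exact absurd hde (lt_irrefl _)
        | succ e => simpa using hi _ (orderEmbOfFin_mem I rfl e)
      | succ d =>
        induction e using Fin.cases with
        | zero => exact absurd hde (Fin.not_lt_zero _)
        | succ e => simpa using hde
    have hr' := orderEmbOfFin_unique hc (f := Fin.cons i (I.orderEmbOfFin rfl))
      (fun d => by refine Fin.cases ?_ (fun d => ?_) d <;> simp) hr
    rw [hsum]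
    refine sum_congr rfl fun p _ => ?_
    have hcard : (J.erase (J.orderEmbOfFin hJ p)).card = I.card := by
      rw [card_erase_of_mem (orderEmbOfFin_mem _ _ _), hJ, Nat.add_sub_cancel]
    have hcol := orderEmbOfFin_unique hcard (f := J.orderEmbOfFin hJ ∘ p.succAbove)
      (fun d => by simp)
      ((J.orderEmbOfFin hJ).strictMono.comp (Fin.strictMono_succAbove p))
    rw [countBelow_orderEmbOfFin, qMinor_eq_qDet q x rfl hcard, ← hcol, ← hr']
    simp [Function.comp_def]
  · rw [qMinor_eq_zero q x (by omega), leftWedge]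
    refine (sum_eq_zero fun j hj => ?_).symm
    rw [qMinor_eq_zero q x, mul_zero, smul_zero]
    have := card_erase_add_one hj
    omega

lemma commute_qMinor {q : K} {x : ℕ → ℕ → A} {y : A} {I J : Finset ℕ}
    (h : ∀ i ∈ I, ∀ j ∈ J, Commute y (x i j)) : Commute y (qMinor q x I J) := by
  unfold qMinor
  split_ifs with hc
  · refine Commute.sum_right _ _ _ fun σ _ => Commute.smul_right ?_ _
    refine Commute.list_prod_right _ _ fun z hz => ?_
    obtain ⟨d, rfl⟩ := List.mem_ofFn.1 hz
    exact h _ (orderEmbOfFin_mem _ _ _) _ (orderEmbOfFin_mem _ _ _)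
  · exact Commute.zero_right y

/-- Expansion of a quantum minor along its last column. -/
lemma qMinor_insert_col {q : K} {m n : ℕ} {x : ℕ → ℕ → A} (hx : IsQMatrix q m n x)
    {c : ℕ} (hc : c ≤ n) (I : Finset ℕ) : I ⊆ Icc 1 m → ∀ J : Finset ℕ, J ⊆ Icc 1 n →
    (∀ j ∈ J, j < c) →
    qMinor q x I (insert c J) = rightWedge q (fun i => x i c) (fun I => qMinor q x I J) I := by
  induction I using Finset.induction_on_min with
  | empty =>
    intro _ J _ _
    rw [qMinor_eq_zero, rightWedge, sum_empty]
    rw [card_empty]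
    exact (card_ne_zero_of_mem (mem_insert_self c J)).symm
  | insert i I hi ih =>
    intro hI J hJ hcJ
    rw [insert_subset_iff, mem_Icc] at hI
    have hiI : i ∉ I := fun h => lt_irrefl _ (hi i h)
    have hcJ' : c ∉ J := fun h => lt_irrefl _ (hcJ c h)
    rw [qMinor_insert_row q x hi, leftWedge, rightWedge, sum_insert hcJ', sum_insert hiI]
    congr 1
    · rw [erase_insert hcJ', erase_insert hiI, countBelow_insert_of_le le_rfl,
        countAbove_insert_of_le le_rfl, countBelow_eq_card hcJ, countAbove_eq_card hi]
      by_cases hcard : I.card = J.card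
      · rw [hcard, (commute_qMinor (q := q) (y := x i c) fun l hl j hj => ?_).eq]
        exact hx.2.2.1 i l j c hI.1.1 (hi l hl) (mem_Icc.1 (hI.2 hl)).2
          (mem_Icc.1 (hJ hj)).1 (hcJ j hj) hc
      · rw [qMinor_eq_zero q x hcard, mul_zero, zero_mul, smul_zero, smul_zero]
    · have hL : ∀ j ∈ J, (-q) ^ countBelow (insert c J) j •
            (x i j * qMinor q x I ((insert c J).erase j))
          = ∑ l ∈ I, (-q) ^ (countBelow J j + countAbove I l) •
            (x i j * qMinor q x (I.erase l) (J.erase j) * x l c) := by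
        intro j hj
        rw [erase_insert_of_ne (hcJ j hj).ne', countBelow_insert_of_le (hcJ j hj).le,
          ih hI.2 _ ((erase_subset _ _).trans hJ) fun b hb => hcJ b (mem_of_mem_erase hb),
          rightWedge, mul_sum, smul_sum]
        simp only [mul_smul_comm, smul_smul, pow_add, mul_assoc]
      have hR : ∀ l ∈ I, (-q) ^ countAbove (insert i I) l •
            (qMinor q x ((insert i I).erase l) J * x l c)
          = ∑ j ∈ J, (-q) ^ (countBelow J j + countAbove I l) •
            (x i j * qMinor q x (I.erase l) (J.erase j) * x l c) := by
        intro l hl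
        rw [erase_insert_of_ne (hi l hl).ne, countAbove_insert_of_le (hi l hl).le,
          qMinor_insert_row q x fun b hb => hi b (mem_of_mem_erase hb), leftWedge, sum_mul,
          smul_sum]
        simp only [smul_mul_assoc, smul_smul, pow_add, mul_comm]
      rw [sum_congr rfl hL, sum_congr rfl hR, sum_comm]

/-- Expanding along a repeated row gives zero. -/
lemma leftWedge_qMinor_eq_zero {q : K} (hq : q ≠ 0) {m n : ℕ} {x : ℕ → ℕ → A}
    (hx : IsQMatrix q m n x) {i : ℕ} (I : Finset ℕ) : I ⊆ Icc 1 m → i ∈ I →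
    ∀ S ⊆ Icc 1 n, leftWedge q (x i) (qMinor q x I) S = 0 := by
  induction I using Finset.induction_on_min with
  | empty => simp
  | insert l I hl ih =>
    intro hI hi S hS
    rw [insert_subset_iff, mem_Icc] at hI
    rw [funext (qMinor_insert_row q x hl)]
    rcases mem_insert.1 hi with rfl | hi
    · exact leftWedge_self_eq_zero (fun j hj k hk hjk => hx.1 i j k hI.1.1 hI.1.2
        (mem_Icc.1 (hS hj)).1 hjk (mem_Icc.1 (hS hk)).2) _
    · rw [leftWedge_swap, leftWedge, sum_eq_zero, smul_zero]
      · intro j _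
        rw [ih hI.2 hi _ ((erase_subset _ _).trans hS), mul_zero, smul_zero]
      · intro j hj k hk hjk
        have hj := (mem_Icc.1 (hS hj)).1
        have hk := (mem_Icc.1 (hS hk)).2
        have him := (mem_Icc.1 (hI.2 hi)).2
        exact manin_swap hq (hx.2.2.1 l i j k hI.1.1 (hl i hi) him hj hjk hk)
          (hx.2.2.2 l i j k hI.1.1 (hl i hi) him hj hjk hk)

/-- Adjoining a column on the right of a quantum minor. -/
lemma rightWedge_qMinor {q : K} (hq : q ≠ 0) {m n : ℕ} {x : ℕ → ℕ → A}
    (hx : IsQMatrix q m n x) {a : ℕ} (ha : a ∈ Icc 1 n) (J : Finset ℕ) : J ⊆ Icc 1 n →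
    ∀ S ⊆ Icc 1 m, rightWedge q (fun i => x i a) (fun I => qMinor q x I J) S =
      if a ∈ J then 0 else (-q) ^ countAbove J a • qMinor q x S (insert a J) := by
  rw [mem_Icc] at ha
  induction J using Finset.induction_on_max with
  | empty =>
    intro hJ S hS
    rw [if_neg (notMem_empty a), qMinor_insert_col hx ha.2 S hS ∅ hJ (by simp)]
    simp [countAbove]
  | insert c J hc ih =>
    intro hJ S hS
    rcases lt_or_ge c a with hca | hac
    · have hlt : ∀ j ∈ insert c J, j < a := by
        simpa only [forall_mem_insert] using ⟨hca, fun j hj => (hc j hj).trans hca⟩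
      rw [if_neg fun h => lt_irrefl _ (hlt a h), ← qMinor_insert_col hx ha.2 S hS _ hJ hlt,
        countAbove_eq_zero fun j hj => (hlt j hj).le, pow_zero, one_smul]
    rw [insert_subset_iff, mem_Icc] at hJ
    have hcJ : c ∉ J := fun h => lt_irrefl _ (hc c h)
    have hcol : ∀ T ⊆ S, qMinor q x T (insert c J)
        = rightWedge q (fun i => x i c) (fun I => qMinor q x I J) T := fun T hT =>
      qMinor_insert_col hx hJ.1.2 T (hT.trans hS) J hJ.2 hc
    have hexp : rightWedge q (fun i => x i a) (fun I => qMinor q x I (insert c J)) S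
        = rightWedge q (fun i => x i a)
          (rightWedge q (fun i => x i c) (fun I => qMinor q x I J)) S :=
      sum_congr rfl fun i _ => by simp only [hcol _ (erase_subset i S)]
    rw [hexp]
    rcases hac.eq_or_lt with rfl | hac
    · rw [if_pos (mem_insert_self _ _)]
      exact rightWedge_self_eq_zero (fun j hj k hk hjk => hx.2.1 j k a
        (mem_Icc.1 (hS hj)).1 hjk (mem_Icc.1 (hS hk)).2 ha.1 ha.2) _
    · have hswap := rightWedge_swap (q := q) (y := fun i => x i a) (z := fun i => x i c) (S := S)
        (fun j hj k hk hjk => by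
          have hj := (mem_Icc.1 (hS hj)).1
          have hk := (mem_Icc.1 (hS hk)).2
          have h1 := hx.2.2.1 j k a c hj hjk hk ha.1 hac hJ.1.2
          have h2 := hx.2.2.2 j k a c hj hjk hk ha.1 hac hJ.1.2
          exact manin_swap hq h1.symm (h1 ▸ h2)) (fun I => qMinor q x I J)
      rw [hswap, rightWedge]
      have hih : ∀ i ∈ S, rightWedge q (fun i => x i a) (fun I => qMinor q x I J) (S.erase i)
          = if a ∈ J then 0 else (-q) ^ countAbove J a • qMinor q x (S.erase i) (insert a J) :=
        fun i _ => ih hJ.2 _ ((erase_subset i S).trans hS)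
      by_cases haJ : a ∈ J
      · rw [if_pos (mem_insert_of_mem haJ), sum_eq_zero, smul_zero]
        intro i hi
        rw [hih i hi, if_pos haJ, zero_mul, smul_zero]
      · rw [if_neg (by simp [haJ, hac.ne]), countAbove_insert_of_lt hcJ hac, insert_comm a c,
          qMinor_insert_col hx hJ.1.2 S hS _ (by simp [insert_subset_iff, ha, hJ.2])
            (by simpa only [forall_mem_insert] using ⟨hac, hc⟩), rightWedge, pow_succ', mul_smul]
        congr 1
        rw [smul_sum]
        exact sum_congr rfl fun i hi => by
          rw [hih i hi, if_neg haJ, smul_mul_assoc, smul_comm]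

end QuantumMinors

/-- The general quadratic identity (7.2):
`Σ_{a ∈ I-J} (-q)^{Inv(a,I-a)-Inv(a,J)} [J∪a][I-a] = 0`. -/
theorem flag_general_identity_two
    {K A : Type} [Field K] [Ring A] [Algebra K A] {m n : ℕ}
    (q : K) (hq : q ≠ 0) (x : ℕ → ℕ → A) (hx : IsQMatrix q m n x)
    (I J : Finset ℕ) (hIn : I ⊆ Finset.Icc 1 n) (hJn : J ⊆ Finset.Icc 1 n)
    (hcard : J.card + 2 ≤ I.card) (hIm : I.card ≤ m + 1) :
    ∑ a ∈ I \ J,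
      ((-q) ^ ((invPairs {a} (I.erase a) : ℤ) - (invPairs {a} J : ℤ))) •
        (flagMinor q x (insert a J) * flagMinor q x (I.erase a)) = 0 := by
  have hq' : -q ≠ 0 := neg_ne_zero.2 hq
  set R := Finset.Icc 1 (J.card + 1)
  set P := Finset.Icc 1 (I.card - 1)
  have hRm : R ⊆ Finset.Icc 1 m := Finset.Icc_subset_Icc_right (by omega)
  have hPm : P ⊆ Finset.Icc 1 m := Finset.Icc_subset_Icc_right (by omega)
  have hRP : R ⊆ P := Finset.Icc_subset_Icc_right (by omega)
  have key : ∑ a ∈ I, (-q) ^ countBelow I a •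
      (rightWedge q (fun i => x i a) (fun T => qMinor q x T J) R * qMinor q x P (I.erase a))
      = 0 := by
    have h : ∀ i ∈ R, (-q) ^ countAbove R i •
        (qMinor q x (R.erase i) J * leftWedge q (x i) (qMinor q x P) I) = 0 := fun i hi => by
      rw [leftWedge_qMinor_eq_zero hq hx P hPm (hRP hi) I hIn, mul_zero, smul_zero]
    rw [← Finset.sum_eq_zero h]
    simp only [rightWedge, leftWedge, Finset.sum_mul, Finset.mul_sum, Finset.smul_sum]
    rw [Finset.sum_comm]
    refine Finset.sum_congr rfl fun i _ => Finset.sum_congr rfl fun a _ => ?_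
    simp only [smul_mul_assoc, mul_smul_comm, mul_assoc]
    rw [smul_comm]
  have hterm : ∀ a ∈ I, (-q) ^ countBelow I a •
      (rightWedge q (fun i => x i a) (fun T => qMinor q x T J) R * qMinor q x P (I.erase a))
      = if a ∈ J then 0 else (-q) ^ J.card •
        ((-q) ^ ((invPairs {a} (I.erase a) : ℤ) - (invPairs {a} J : ℤ)) •
          (flagMinor q x (insert a J) * flagMinor q x (I.erase a))) := fun a ha => by
    rw [rightWedge_qMinor hq hx (hIn ha) J hJn R hRm]
    split_ifs with haJ
    · rw [zero_mul, smul_zero]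
    · rw [flagMinor, flagMinor, Finset.card_insert_of_notMem haJ, Finset.card_erase_of_mem ha,
        invPairs_singleton, invPairs_singleton, countBelow_erase_of_le le_rfl, smul_mul_assoc,
        smul_smul, smul_smul]
      congr 1
      rw [← countBelow_add_countAbove haJ, ← zpow_natCast, ← zpow_natCast, ← zpow_natCast,
        ← zpow_add₀ hq', ← zpow_add₀ hq']
      congr 1
      push_cast
      ring
  rw [Finset.sum_congr rfl hterm, Finset.sum_ite, Finset.sum_const_zero, zero_add,
    ← Finset.smul_sum, ← Finset.sdiff_eq_filter] at key
  exact (smul_eq_zero_iff_right (pow_ne_zero _ hq')).1 key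
end
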